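/- arXiv:math/9201288 — 2 statements merged into one kernel-verified Lean document; each statement's English description precedes it below -/
import Mathlib

section
/- Let {f_ε}_{0≤ε≤ε₀} be a good family with power law exponent γ > 1, and for each ε let Λ_ε = {x ∈ [-1,1] : f_εⁿ(x) ∈ [-1,1] for all n ≥ 0} be the maximal invariant set and HD(ε) its Hausdorff dimension. Then there is a constant C > 0, not depending on ε, such that 0 < HD(ε) ≤ 1 − Cε^{1/γ} for all 0 ≤ ε ≤ ε₀. -/
open Set MeasureTheory Filter Topology

noncomputable def len (s : Set ℝ) : ℝ := (volume s).toReal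

noncomputable def branch (f : ℝ → ℝ) : Bool → ℝ → ℝ
  | false => Function.invFunOn f (Icc (-1) 0)
  | true => Function.invFunOn f (Icc 0 1)

noncomputable def gw (f : ℝ → ℝ) : List Bool → ℝ → ℝ
  | [] => id
  | b :: w => branch f b ∘ gw f w

noncomputable def Iw (f : ℝ → ℝ) (w : List Bool) : Set ℝ := gw f w '' Icc (-1) 1

def word (a : ℕ → Bool) (n : ℕ) : List Bool := ((List.range (n + 1)).reverse).map a

noncomputable def ratio (f : ℝ → ℝ) (a : ℕ → Bool) (n : ℕ) : ℝ :=
  len (Iw f (word a n)) / len (Iw f ((word a n).dropLast))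

def IsScalingFun (f : ℝ → ℝ) (s : (ℕ → Bool) → ℝ) : Prop :=
  ∀ a : ℕ → Bool, Tendsto (ratio f a) atTop (nhds (s a))

def HolderOnDual (s : (ℕ → Bool) → ℝ) : Prop :=
  ∃ C > (0:ℝ), ∃ lam ∈ Ioo (0:ℝ) 1, ∀ a b : ℕ → Bool, ∀ n : ℕ,
    (∀ k < n, a k = b k) → |s a - s b| ≤ C * lam ^ n

def EvZero (a : ℕ → Bool) : Prop := ∃ N, ∀ n ≥ N, a n = false

def Lambda (f : ℝ → ℝ) : Set ℝ := {x | ∀ n : ℕ, f^[n] x ∈ Icc (-1) 1}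

structure GoodFamily where
  eps0 : ℝ
  eps0_pos : 0 < eps0
  f : ℝ → ℝ → ℝ
  f' : ℝ → ℝ → ℝ
  gamma : ℝ
  one_lt_gamma : 1 < gamma
  mono : ∀ ε ∈ Icc 0 eps0, StrictMonoOn (f ε) (Icc (-1) 0)
  anti : ∀ ε ∈ Icc 0 eps0, StrictAntiOn (f ε) (Icc 0 1)
  map_neg_one : ∀ ε ∈ Icc 0 eps0, f ε (-1) = -1
  map_one : ∀ ε ∈ Icc 0 eps0, f ε 1 = -1
  map_zero : ∀ ε ∈ Icc 0 eps0, f ε 0 = 1 + ε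
  smooth : ContDiffOn ℝ 1 (fun p : ℝ × ℝ => f p.1 p.2) (Icc 0 eps0 ×ˢ Icc (-1) 1)
  deriv_f : ∀ ε ∈ Icc 0 eps0, ∀ x ∈ Icc (-1:ℝ) 1,
    HasDerivWithinAt (f ε) (f' ε x) (Icc (-1) 1) x
  Rneg : ℝ → ℝ → ℝ
  Rpos : ℝ → ℝ → ℝ
  Rneg_cont : ContinuousOn (fun p : ℝ × ℝ => Rneg p.1 p.2) (Icc 0 eps0 ×ˢ Icc (-1) 0)
  Rpos_cont : ContinuousOn (fun p : ℝ × ℝ => Rpos p.1 p.2) (Icc 0 eps0 ×ˢ Icc 0 1)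
  Rneg_ne : ∀ ε ∈ Icc 0 eps0, ∀ x ∈ Icc (-1:ℝ) 0, Rneg ε x ≠ 0
  Rpos_ne : ∀ ε ∈ Icc 0 eps0, ∀ x ∈ Icc (0:ℝ) 1, Rpos ε x ≠ 0
  Rneg_eq : ∀ ε ∈ Icc 0 eps0, ∀ x ∈ Ico (-1:ℝ) 0, Rneg ε x = f' ε x / |x| ^ (gamma - 1)
  Rpos_eq : ∀ ε ∈ Icc 0 eps0, ∀ x ∈ Ioc (0:ℝ) 1, Rpos ε x = f' ε x / |x| ^ (gamma - 1)
  K' : ℝ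
  K'_pos : 0 < K'
  alpha' : ℝ
  alpha'_mem : alpha' ∈ Ioc (0:ℝ) 1
  holder' : ∀ ε ∈ Icc 0 eps0, ∀ x ∈ Icc (-1:ℝ) 1, ∀ y ∈ Icc (-1:ℝ) 1,
    |f' ε x - f' ε y| ≤ K' * |x - y| ^ alpha'
  K'' : ℝ
  K''_pos : 0 < K''
  alpha'' : ℝ
  alpha''_mem : alpha'' ∈ Ioc (0:ℝ) 1
  holder''_neg : ∀ ε ∈ Icc 0 eps0, ∀ x ∈ Ico (-1:ℝ) 0, ∀ y ∈ Ico (-1:ℝ) 0,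
    |f' ε x / |x| ^ (gamma - 1) - f' ε y / |y| ^ (gamma - 1)| ≤ K'' * |x - y| ^ alpha''
  holder''_pos : ∀ ε ∈ Icc 0 eps0, ∀ x ∈ Ioc (0:ℝ) 1, ∀ y ∈ Ioc (0:ℝ) 1,
    |f' ε x / |x| ^ (gamma - 1) - f' ε y / |y| ^ (gamma - 1)| ≤ K'' * |x - y| ^ alpha''
  C0 : ℝ
  C0_pos : 0 < C0
  lam : ℝ
  lam_mem : lam ∈ Ioo (0:ℝ) 1
  decay : ∀ ε ∈ Icc 0 eps0, ∀ n : ℕ, 1 ≤ n → ∀ w : List Bool, w.length = n + 1 →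
    len (Iw (f ε) w) ≤ C0 * lam ^ n

/-- `p` is an increasing function on `[0, 1]` whose derivative `p'` is comparable to `t ^ (γ - 1)`,
with Hölder control on `p'` and on the ratio `p' t / t ^ (γ - 1)`. -/
structure PowerProfile (γ m M K α : ℝ) (p p' : ℝ → ℝ) : Prop where
  one_lt : 1 < γ
  m_pos : 0 < m
  K_nonneg : 0 ≤ K
  α_pos : 0 < α
  α_le : α ≤ 1
  cont : ContinuousOn p (Icc 0 1)
  hasDeriv : ∀ t ∈ Ioo (0:ℝ) 1, HasDerivAt p (p' t) t
  lower : ∀ t ∈ Ioc (0:ℝ) 1, m * t ^ (γ - 1) ≤ p' t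
  upper : ∀ t ∈ Ioc (0:ℝ) 1, p' t ≤ M * t ^ (γ - 1)
  holder_ratio : ∀ s ∈ Ioc (0:ℝ) 1, ∀ t ∈ Ioc (0:ℝ) 1,
    |p' s / s ^ (γ - 1) - p' t / t ^ (γ - 1)| ≤ K * |s - t| ^ α
  holder : ∀ s ∈ Ioc (0:ℝ) 1, ∀ t ∈ Ioc (0:ℝ) 1, |p' s - p' t| ≤ K * |s - t| ^ α

namespace PowerProfile

variable {γ m M K α : ℝ} {p p' : ℝ → ℝ}

lemma m_le_M (h : PowerProfile γ m M K α p p') : m ≤ M := by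
  have h1 := h.lower 1 (by simp)
  have h2 := h.upper 1 (by simp)
  simp only [Real.one_rpow, mul_one] at h1 h2
  linarith

lemma M_pos (h : PowerProfile γ m M K α p p') : 0 < M := h.m_pos.trans_le h.m_le_M

lemma deriv_pos (h : PowerProfile γ m M K α p p') {t : ℝ} (ht : t ∈ Ioc (0:ℝ) 1) : 0 < p' t :=
  (mul_pos h.m_pos (Real.rpow_pos_of_pos ht.1 _)).trans_le (h.lower t ht)

lemma exists_slope (h : PowerProfile γ m M K α p p') {a b : ℝ} (ha : 0 ≤ a) (hab : a < b)
    (hb : b ≤ 1) : ∃ ξ ∈ Ioo a b, p b - p a = p' ξ * (b - a) := by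
  obtain ⟨ξ, hξ, he⟩ := exists_hasDerivAt_eq_slope p p' hab
    (h.cont.mono (Icc_subset_Icc ha hb))
    (fun t ht => h.hasDeriv t ⟨ha.trans_lt ht.1, ht.2.trans_le hb⟩)
  refine ⟨ξ, hξ, ?_⟩
  rw [he, div_mul_cancel₀ _ (sub_pos.2 hab).ne']

lemma strictMonoOn (h : PowerProfile γ m M K α p p') : StrictMonoOn p (Icc 0 1) := by
  intro a ha b hb hab
  obtain ⟨ξ, hξ, he⟩ := h.exists_slope ha.1 hab hb.2
  have := mul_pos (h.deriv_pos ⟨ha.1.trans_lt hξ.1, hξ.2.le.trans hb.2⟩) (sub_pos.2 hab)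
  linarith

lemma sub_le (h : PowerProfile γ m M K α p p') {a b : ℝ} (ha : 0 ≤ a) (hab : a ≤ b)
    (hb : b ≤ 1) : p b - p a ≤ M * b ^ (γ - 1) * (b - a) := by
  rcases hab.eq_or_lt with rfl | hab
  · simp
  obtain ⟨ξ, hξ, he⟩ := h.exists_slope ha hab hb
  rw [he]
  have hξ0 : 0 < ξ := ha.trans_lt hξ.1
  refine mul_le_mul_of_nonneg_right ((h.upper ξ ⟨hξ0, hξ.2.le.trans hb⟩).trans ?_)
    (sub_pos.2 hab).le
  exact mul_le_mul_of_nonneg_left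
    (Real.rpow_le_rpow hξ0.le hξ.2.le (by linarith [h.one_lt])) h.M_pos.le

lemma le_sub (h : PowerProfile γ m M K α p p') {a b : ℝ} (ha : 0 ≤ a) (hab : a ≤ b)
    (hb : b ≤ 1) : m / 2 ^ γ * b ^ (γ - 1) * (b - a) ≤ p b - p a := by
  rcases hab.eq_or_lt with rfl | hab
  · simp
  have hb0 : 0 < b := ha.trans_lt hab
  obtain ⟨ξ, hξ, he⟩ := h.exists_slope (a := (a + b) / 2) (by linarith) (by linarith) hb
  have hmono : p a ≤ p ((a + b) / 2) :=
    h.strictMonoOn.monotoneOn ⟨ha, by linarith⟩ ⟨by linarith, by linarith⟩ (by linarith)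
  have h1 : m * (b / 2) ^ (γ - 1) ≤ p' ξ := by
    refine le_trans ?_ (h.lower ξ ⟨by linarith [hξ.1], hξ.2.le.trans hb⟩)
    exact mul_le_mul_of_nonneg_left (Real.rpow_le_rpow (by linarith) (by linarith [hξ.1])
      (by linarith [h.one_lt])) h.m_pos.le
  have h2 := mul_le_mul_of_nonneg_right h1 (show 0 ≤ b - (a + b) / 2 by linarith)
  have h3 : m * (b / 2) ^ (γ - 1) * (b - (a + b) / 2) = m / 2 ^ γ * b ^ (γ - 1) * (b - a) := by
    rw [Real.div_rpow hb0.le (by norm_num), Real.rpow_sub_one (x := 2) (by norm_num)]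
    have : (2:ℝ) ^ γ ≠ 0 := (Real.rpow_pos_of_pos (by norm_num) _).ne'
    field_simp
    ring
  linarith

/-- The crude distortion constant. -/
noncomputable def crude (γ m M : ℝ) : ℝ := M * 2 ^ γ / m

lemma crude_pos (h : PowerProfile γ m M K α p p') : 0 < crude γ m M :=
  div_pos (mul_pos h.M_pos (Real.rpow_pos_of_pos (by norm_num) _)) h.m_pos

lemma one_le_crude (h : PowerProfile γ m M K α p p') : 1 ≤ crude γ m M := by
  rw [crude, one_le_div h.m_pos]
  have := Real.one_le_rpow (x := 2) (z := γ) (by norm_num) (by linarith [h.one_lt])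
  nlinarith [h.m_le_M, h.M_pos]

lemma M_mul_le (h : PowerProfile γ m M K α p p') {a b : ℝ} (ha : 0 ≤ a) (hab : a ≤ b)
    (hb : b ≤ 1) : M * b ^ (γ - 1) * (b - a) ≤ crude γ m M * (p b - p a) := by
  have h1 := mul_le_mul_of_nonneg_left (h.le_sub ha hab hb) h.crude_pos.le
  have h2 : crude γ m M * (m / 2 ^ γ * b ^ (γ - 1) * (b - a)) = M * b ^ (γ - 1) * (b - a) := by
    have : (2:ℝ) ^ γ ≠ 0 := (Real.rpow_pos_of_pos (by norm_num) _).ne'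
    have := h.m_pos.ne'
    unfold crude
    field_simp
  linarith

lemma crude_distortion (h : PowerProfile γ m M K α p p') {a b x y : ℝ} (ha : 0 ≤ a) (hb : b ≤ 1)
    (hax : a ≤ x) (hxy : x ≤ y) (hyb : y ≤ b) :
    (p y - p x) * (b - a) ≤ crude γ m M * (p b - p a) * (y - x) := by
  have h1 := h.sub_le (ha.trans hax) hxy (hyb.trans hb)
  have h2 := h.M_mul_le ha (hax.trans (hxy.trans hyb)) hb
  have h3 : M * y ^ (γ - 1) ≤ M * b ^ (γ - 1) := mul_le_mul_of_nonneg_left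
    (Real.rpow_le_rpow (by linarith) hyb (by linarith [h.one_lt])) h.M_pos.le
  calc (p y - p x) * (b - a) ≤ M * y ^ (γ - 1) * (y - x) * (b - a) :=
        mul_le_mul_of_nonneg_right h1 (by linarith)
    _ ≤ M * b ^ (γ - 1) * (y - x) * (b - a) := by
        gcongr; linarith
    _ = M * b ^ (γ - 1) * (b - a) * (y - x) := by ring
    _ ≤ _ := mul_le_mul_of_nonneg_right h2 (by linarith)

lemma fine_distortion (h : PowerProfile γ m M K α p p') {a b x y D : ℝ} (ha : 0 < a) (hb : b ≤ 1)
    (hax : a ≤ x) (hxy : x ≤ y) (hyb : y ≤ b) (hD : b - a ≤ D * a) :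
    (p y - p x) * (b - a) ≤
      Real.exp (K / m * (b - a) ^ α + (γ - 1) * D) * (p b - p a) * (y - x) := by
  rcases hxy.eq_or_lt with rfl | hxy
  · simp
  have hab : a < b := by linarith
  obtain ⟨ξ, hξ, he⟩ := h.exists_slope (by linarith) hxy (hyb.trans hb)
  obtain ⟨η, hη, he'⟩ := h.exists_slope ha.le hab hb
  have hγ : 0 < γ - 1 := by linarith [h.one_lt]
  have hξ0 : 0 < ξ := by linarith [hξ.1]
  have hη0 : 0 < η := by linarith [hη.1]
  have hξ1 : ξ ∈ Ioc (0:ℝ) 1 := ⟨hξ0, by linarith [hξ.2]⟩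
  have hη1 : η ∈ Ioc (0:ℝ) 1 := ⟨hη0, by linarith [hη.2]⟩
  have hξp := Real.rpow_pos_of_pos hξ0 (γ - 1)
  have hηp := Real.rpow_pos_of_pos hη0 (γ - 1)
  have hr : p' ξ / ξ ^ (γ - 1) ≤ Real.exp (K / m * (b - a) ^ α) * (p' η / η ^ (γ - 1)) := by
    have h1 := (le_abs_self _).trans (h.holder_ratio ξ hξ1 η hη1)
    have h2 : |ξ - η| ^ α ≤ (b - a) ^ α := by
      refine Real.rpow_le_rpow (abs_nonneg _) ?_ h.α_pos.le
      rw [abs_le]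
      constructor <;> linarith [hξ.1, hξ.2, hη.1, hη.2]
    have h3 : m ≤ p' η / η ^ (γ - 1) := by
      rw [le_div_iff₀ hηp]; exact h.lower η hη1
    have h4 := Real.add_one_le_exp (K / m * (b - a) ^ α)
    have h5 : 0 ≤ K / m * (b - a) ^ α :=
      mul_nonneg (div_nonneg h.K_nonneg h.m_pos.le) (Real.rpow_nonneg (by linarith) _)
    have h6 : K * (b - a) ^ α = K / m * (b - a) ^ α * m := by
      have := h.m_pos.ne'
      field_simp
    have h7 : K * |ξ - η| ^ α ≤ K * (b - a) ^ α := mul_le_mul_of_nonneg_left h2 h.K_nonneg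
    have h8 := mul_le_mul_of_nonneg_left h3 h5
    have h9 := mul_le_mul_of_nonneg_right h4 (h.m_pos.le.trans h3)
    linarith
  have hpow : ξ ^ (γ - 1) ≤ Real.exp ((γ - 1) * D) * η ^ (γ - 1) := by
    have h1 : ξ ≤ Real.exp D * η := by
      have h2 := Real.add_one_le_exp D
      have h3 := mul_le_mul_of_nonneg_right h2 ha.le
      have h4 : Real.exp D * a ≤ Real.exp D * η :=
        mul_le_mul_of_nonneg_left hη.1.le (Real.exp_pos _).le
      linarith [hξ.2]
    calc ξ ^ (γ - 1) ≤ (Real.exp D * η) ^ (γ - 1) := Real.rpow_le_rpow hξ0.le h1 hγ.le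
      _ = _ := by
        rw [Real.mul_rpow (Real.exp_pos _).le hη0.le, ← Real.exp_mul, mul_comm D]
  have hfin : p' ξ ≤ Real.exp (K / m * (b - a) ^ α + (γ - 1) * D) * p' η := by
    have h1 : p' ξ = p' ξ / ξ ^ (γ - 1) * ξ ^ (γ - 1) := by field_simp
    have h2 : p' η = p' η / η ^ (γ - 1) * η ^ (γ - 1) := by field_simp
    have h3 := mul_le_mul hr hpow hξp.le
      (mul_nonneg (Real.exp_pos _).le (div_pos (h.deriv_pos hη1) hηp).le)
    rw [h1, h2, Real.exp_add]
    linarith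
  rw [he, he']
  have h4 := mul_le_mul_of_nonneg_right hfin
    (mul_nonneg (sub_pos.2 hxy).le (sub_pos.2 hab).le)
  linarith

lemma sub_le_mul_of_le (h : PowerProfile γ m M K α p p') (h0 : p 0 = 0) {a b r : ℝ} (ha : 0 ≤ a)
    (hab : a < b) (hb : b ≤ 1) (hr : 0 ≤ r) (hp : p b - p a ≤ r * p a) :
    b - a ≤ crude γ m M * r * a := by
  have hb0 : 0 < b := ha.trans_lt hab
  have h1 := h.M_mul_le ha hab.le hb
  have h2 : p a ≤ M * b ^ (γ - 1) * a := by
    have h3 := h.sub_le le_rfl ha (hab.le.trans hb)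
    rw [h0, sub_zero, sub_zero] at h3
    refine h3.trans (mul_le_mul_of_nonneg_right (mul_le_mul_of_nonneg_left
      (Real.rpow_le_rpow ha hab.le (by linarith [h.one_lt])) h.M_pos.le) ha)
  have h3 : 0 < M * b ^ (γ - 1) := mul_pos h.M_pos (Real.rpow_pos_of_pos hb0 _)
  have h4 := mul_le_mul_of_nonneg_left (hp.trans (mul_le_mul_of_nonneg_left h2 hr)) h.crude_pos.le
  refine le_of_mul_le_mul_left ?_ h3
  linarith

lemma crude_end (h : PowerProfile γ m M K α p p') {a b : ℝ} (ha : 0 ≤ a) (hab : a ≤ b)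
    (hb : b ≤ 1) (hb2 : 1 / 2 ≤ b) :
    (b - a) * (p 1 - p b) ≤ crude γ m M * 2 ^ (γ - 1) * (p b - p a) * (1 - b) := by
  have h1 := h.M_mul_le ha hab hb
  have h2 := h.sub_le (by linarith) hb le_rfl
  rw [Real.one_rpow, mul_one] at h2
  have h3 : 1 ≤ 2 ^ (γ - 1) * b ^ (γ - 1) := by
    rw [← Real.mul_rpow (by norm_num) (by linarith)]
    exact Real.one_le_rpow (by linarith) (by linarith [h.one_lt])
  have h2p : (0:ℝ) < 2 ^ (γ - 1) := Real.rpow_pos_of_pos (by norm_num) _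
  calc (b - a) * (p 1 - p b) ≤ (b - a) * (M * (1 - b)) :=
        mul_le_mul_of_nonneg_left h2 (by linarith)
    _ = 1 * ((b - a) * (M * (1 - b))) := by ring
    _ ≤ (2 ^ (γ - 1) * b ^ (γ - 1)) * ((b - a) * (M * (1 - b))) :=
        mul_le_mul_of_nonneg_right h3
          (mul_nonneg (by linarith) (mul_nonneg h.M_pos.le (by linarith)))
    _ = M * b ^ (γ - 1) * (b - a) * (2 ^ (γ - 1) * (1 - b)) := by ring
    _ ≤ crude γ m M * (p b - p a) * (2 ^ (γ - 1) * (1 - b)) :=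
        mul_le_mul_of_nonneg_right h1 (mul_nonneg h2p.le (by linarith))
    _ = _ := by ring

/-- The constant governing the distortion of a profile near the endpoint `1`. -/
noncomputable def endConst (γ m M K : ℝ) : ℝ :=
  4 / 3 * (crude γ m M * 2 ^ (γ - 1)) + K * 4 ^ (γ - 1) / m

lemma endConst_nonneg (h : PowerProfile γ m M K α p p') : 0 ≤ endConst γ m M K := by
  have h1 := h.crude_pos.le
  have h2 := h.m_pos.le
  have h3 := h.K_nonneg
  unfold endConst
  positivity

lemma fine_end (h : PowerProfile γ m M K α p p') {a b d : ℝ} (ha : 0 ≤ a) (hab : a ≤ b)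
    (hb : b ≤ 1) (hb2 : 1 / 2 ≤ b) (hd : 1 - a ≤ d) :
    (b - a) * (p 1 - p b) ≤ (1 + endConst γ m M K * d ^ α) * (p b - p a) * (1 - b) := by
  have hcr : 0 ≤ crude γ m M * 2 ^ (γ - 1) :=
    mul_nonneg h.crude_pos.le (Real.rpow_nonneg (by norm_num) _)
  have hK4 : 0 ≤ K * 4 ^ (γ - 1) / m :=
    div_nonneg (mul_nonneg h.K_nonneg (Real.rpow_nonneg (by norm_num) _)) h.m_pos.le
  rcases hab.eq_or_lt with rfl | hab
  · simp
  rcases hb.eq_or_lt with rfl | hb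
  · simp
  have hpab : 0 ≤ p b - p a := by
    have := h.strictMonoOn ⟨ha, by linarith⟩ ⟨by linarith, hb.le⟩ hab
    linarith
  by_cases ha4 : a < 1 / 4
  · refine (h.crude_end ha hab.le hb.le hb2).trans ?_
    have hdα : 3 / 4 ≤ d ^ α := by
      rcases le_or_gt d 1 with hd1 | hd1
      · have := Real.rpow_le_rpow_of_exponent_ge (x := d) (by linarith) hd1 h.α_le
        rw [Real.rpow_one] at this
        linarith
      · have := Real.one_le_rpow hd1.le h.α_pos.le
        linarith
    gcongr ?_ * _ * _
    unfold endConst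
    nlinarith [mul_le_mul_of_nonneg_left hdα hcr, mul_nonneg hK4 (by linarith : 0 ≤ d ^ α)]
  · push Not at ha4
    obtain ⟨ξ, hξ, he⟩ := h.exists_slope ha hab hb.le
    obtain ⟨η, hη, he'⟩ := h.exists_slope (a := b) (by linarith) hb le_rfl
    have hξ1 : ξ ∈ Ioc (0:ℝ) 1 := ⟨by linarith [hξ.1], by linarith [hξ.2]⟩
    have hη1 : η ∈ Ioc (0:ℝ) 1 := ⟨by linarith [hη.1], by linarith [hη.2]⟩
    have h1 := (le_abs_self _).trans (h.holder η hη1 ξ hξ1)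
    have h2 : |η - ξ| ^ α ≤ d ^ α := by
      refine Real.rpow_le_rpow (abs_nonneg _) ?_ h.α_pos.le
      rw [abs_le]
      constructor <;> linarith [hξ.1, hξ.2, hη.1, hη.2]
    have h3 : m ≤ 4 ^ (γ - 1) * p' ξ := by
      have h4 : 1 ≤ 4 ^ (γ - 1) * ξ ^ (γ - 1) := by
        rw [← Real.mul_rpow (by norm_num) hξ1.1.le]
        exact Real.one_le_rpow (by linarith [hξ.1]) (by linarith [h.one_lt])
      have h5 := mul_le_mul_of_nonneg_left (h.lower ξ hξ1)
        (Real.rpow_nonneg (by norm_num : (0:ℝ) ≤ 4) (γ - 1))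
      nlinarith [h.m_pos]
    have hdα : 0 ≤ d ^ α := Real.rpow_nonneg (by linarith) _
    have hpξ := h.deriv_pos hξ1
    have h6 : K * |η - ξ| ^ α ≤ K * 4 ^ (γ - 1) / m * d ^ α * p' ξ := by
      have h7 : K * d ^ α * m ≤ K * d ^ α * (4 ^ (γ - 1) * p' ξ) :=
        mul_le_mul_of_nonneg_left h3 (mul_nonneg h.K_nonneg hdα)
      calc K * |η - ξ| ^ α ≤ K * d ^ α := mul_le_mul_of_nonneg_left h2 h.K_nonneg
        _ ≤ K * d ^ α * (4 ^ (γ - 1) * p' ξ) / m := by rwa [le_div_iff₀ h.m_pos]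
        _ = _ := by ring
    have h8 : p' η ≤ (1 + endConst γ m M K * d ^ α) * p' ξ := by
      have : 0 ≤ 4 / 3 * (crude γ m M * 2 ^ (γ - 1)) * d ^ α * p' ξ := by positivity
      unfold endConst
      linarith
    rw [he, he']
    have := mul_le_mul_of_nonneg_right h8
      (mul_nonneg (sub_pos.2 hab).le (sub_pos.2 hb).le)
    linarith

end PowerProfile

/-- The sign of the half-interval selected by a letter. -/
def letterSign : Bool → ℝ
  | false => -1
  | true => 1

lemma abs_letterSign (b : Bool) : |letterSign b| = 1 := by
  cases b <;> simp [letterSign]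

/-- The left endpoint of the interval of a word. -/
noncomputable def lo (f : ℝ → ℝ) (w : List Bool) : ℝ := min (gw f w (-1)) (gw f w 1)

/-- The right endpoint of the interval of a word. -/
noncomputable def hi (f : ℝ → ℝ) (w : List Bool) : ℝ := max (gw f w (-1)) (gw f w 1)

/-- A two-branched map `f (± t) = 1 + e - p t` with increasing profiles `p`. -/
structure TwoBranched (e : ℝ) (f : ℝ → ℝ) (p : Bool → ℝ → ℝ) : Prop where
  e_nonneg : 0 ≤ e
  map_eq : ∀ b, ∀ t ∈ Icc (0:ℝ) 1, f (letterSign b * t) = 1 + e - p b t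
  cont : ∀ b, ContinuousOn (p b) (Icc 0 1)
  mono : ∀ b, StrictMonoOn (p b) (Icc 0 1)
  map_zero : ∀ b, p b 0 = 0
  map_one : ∀ b, p b 1 = 2 + e

namespace TwoBranched

variable {e : ℝ} {f : ℝ → ℝ} {p : Bool → ℝ → ℝ}

lemma exists_branch (h : TwoBranched e f p) (b : Bool) {y : ℝ} (hy : y ∈ Icc (-1:ℝ) 1) :
    ∃ t ∈ Icc (0:ℝ) 1, branch f b y = letterSign b * t ∧ p b t = 1 + e - y := by
  have himg : 1 + e - y ∈ p b '' Icc 0 1 := by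
    refine intermediate_value_Icc zero_le_one (h.cont b) ?_
    rw [h.map_zero, h.map_one]
    constructor <;> linarith [hy.1, hy.2, h.e_nonneg]
  obtain ⟨t, ht, hpt⟩ := himg
  have hft : f (letterSign b * t) = y := by rw [h.map_eq b t ht, hpt]; ring
  cases b
  · have hex : ∃ a ∈ Icc (-1:ℝ) 0, f a = y :=
      ⟨_, by simp only [letterSign]; constructor <;> linarith [ht.1, ht.2], hft⟩
    have h1 := Function.invFunOn_mem hex
    have h2 := Function.invFunOn_eq hex
    set x := Function.invFunOn f (Icc (-1) 0) y with hx
    have hx' : -x ∈ Icc (0:ℝ) 1 := ⟨by linarith [h1.2], by linarith [h1.1]⟩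
    refine ⟨-x, hx', by simp [branch, letterSign, hx], ?_⟩
    have := h.map_eq false (-x) hx'
    rw [show letterSign false * -x = x by simp [letterSign], h2] at this
    linarith
  · have hex : ∃ a ∈ Icc (0:ℝ) 1, f a = y :=
      ⟨_, by simp only [letterSign]; constructor <;> linarith [ht.1, ht.2], hft⟩
    have h1 := Function.invFunOn_mem hex
    have h2 := Function.invFunOn_eq hex
    set x := Function.invFunOn f (Icc 0 1) y with hx
    refine ⟨x, h1, by simp [branch, letterSign, hx], ?_⟩
    have := h.map_eq true x h1
    rw [show letterSign true * x = x by simp [letterSign], h2] at this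
    linarith

lemma branch_strictMonoOn (h : TwoBranched e f p) :
    StrictMonoOn (branch f false) (Icc (-1) 1) := by
  intro x hx y hy hxy
  obtain ⟨s, hs, h1, h2⟩ := h.exists_branch false hx
  obtain ⟨t, ht, h3, h4⟩ := h.exists_branch false hy
  have : t < s := ((h.mono false).lt_iff_lt ht hs).1 (by linarith)
  rw [h1, h3]
  simp only [letterSign]
  linarith

lemma branch_strictAntiOn (h : TwoBranched e f p) :
    StrictAntiOn (branch f true) (Icc (-1) 1) := by
  intro x hx y hy hxy
  obtain ⟨s, hs, h1, h2⟩ := h.exists_branch true hx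
  obtain ⟨t, ht, h3, h4⟩ := h.exists_branch true hy
  have : t < s := ((h.mono true).lt_iff_lt ht hs).1 (by linarith)
  rw [h1, h3]
  simp only [letterSign]
  linarith

lemma branch_mem (h : TwoBranched e f p) (b : Bool) {y : ℝ} (hy : y ∈ Icc (-1:ℝ) 1) :
    branch f b y ∈ Icc (-1:ℝ) 1 := by
  obtain ⟨t, ht, h1, -⟩ := h.exists_branch b hy
  rw [h1, mem_Icc, ← abs_le, abs_mul, abs_letterSign, one_mul, abs_of_nonneg ht.1]
  exact ht.2

lemma map_branch (h : TwoBranched e f p) (b : Bool) {y : ℝ} (hy : y ∈ Icc (-1:ℝ) 1) :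
    f (branch f b y) = y := by
  obtain ⟨t, ht, h1, h2⟩ := h.exists_branch b hy
  rw [h1, h.map_eq b t ht, h2]
  ring

lemma branch_eq (h : TwoBranched e f p) (b : Bool) {t : ℝ} (ht : t ∈ Icc (0:ℝ) 1)
    (hf : f (letterSign b * t) ∈ Icc (-1:ℝ) 1) :
    branch f b (f (letterSign b * t)) = letterSign b * t := by
  obtain ⟨s, hs, h1, h2⟩ := h.exists_branch b hf
  rw [h1]
  rw [h.map_eq b t ht] at h2
  rw [(h.mono b).injOn hs ht (by linarith)]

lemma gw_mem (h : TwoBranched e f p) (w : List Bool) {x : ℝ} (hx : x ∈ Icc (-1:ℝ) 1) :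
    gw f w x ∈ Icc (-1:ℝ) 1 := by
  induction w with
  | nil => exact hx
  | cons b w ih => exact h.branch_mem b ih

lemma gw_mono_or_anti (h : TwoBranched e f p) (w : List Bool) :
    StrictMonoOn (gw f w) (Icc (-1) 1) ∨ StrictAntiOn (gw f w) (Icc (-1) 1) := by
  induction w with
  | nil => exact Or.inl fun _ _ _ _ hxy => hxy
  | cons b w ih =>
    have hm : MapsTo (gw f w) (Icc (-1) 1) (Icc (-1) 1) := fun _ => h.gw_mem w
    cases b
    · exact ih.imp (h.branch_strictMonoOn.comp · hm) (h.branch_strictMonoOn.comp_strictAntiOn · hm)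
    · exact ih.symm.imp (h.branch_strictAntiOn.comp · hm)
        (h.branch_strictAntiOn.comp_strictMonoOn · hm)

lemma gw_mem_Icc (h : TwoBranched e f p) (w : List Bool) {x : ℝ} (hx : x ∈ Icc (-1:ℝ) 1) :
    gw f w x ∈ Icc (lo f w) (hi f w) := by
  have h1 : (-1:ℝ) ∈ Icc (-1:ℝ) 1 := by simp
  have h2 : (1:ℝ) ∈ Icc (-1:ℝ) 1 := by simp
  rcases h.gw_mono_or_anti w with hw | hw
  · exact ⟨(min_le_left _ _).trans (hw.monotoneOn h1 hx hx.1),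
      (hw.monotoneOn hx h2 hx.2).trans (le_max_right _ _)⟩
  · exact ⟨(min_le_right _ _).trans (hw.antitoneOn hx h2 hx.2),
      (hw.antitoneOn h1 hx hx.1).trans (le_max_left _ _)⟩

lemma lo_lt_hi (h : TwoBranched e f p) (w : List Bool) : lo f w < hi f w := by
  have h1 : (-1:ℝ) ∈ Icc (-1:ℝ) 1 := by simp
  have h2 : (1:ℝ) ∈ Icc (-1:ℝ) 1 := by simp
  refine min_lt_max.2 ?_
  rcases h.gw_mono_or_anti w with hw | hw
  · exact (hw h1 h2 (by norm_num)).ne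
  · exact (hw h1 h2 (by norm_num)).ne'

lemma lo_mem (h : TwoBranched e f p) (w : List Bool) : lo f w ∈ Icc (-1:ℝ) 1 := by
  have h1 := h.gw_mem w (x := -1) (by simp)
  have h2 := h.gw_mem w (x := 1) (by simp)
  exact ⟨le_min h1.1 h2.1, (min_le_left _ _).trans h1.2⟩

lemma hi_mem (h : TwoBranched e f p) (w : List Bool) : hi f w ∈ Icc (-1:ℝ) 1 := by
  have h1 := h.gw_mem w (x := -1) (by simp)
  have h2 := h.gw_mem w (x := 1) (by simp)
  exact ⟨h1.1.trans (le_max_left _ _), max_le h1.2 h2.2⟩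

lemma exists_hi_eq (f : ℝ → ℝ) (w : List Bool) : ∃ x ∈ Icc (-1:ℝ) 1, gw f w x = hi f w := by
  rcases max_choice (gw f w (-1)) (gw f w 1) with hx | hx
  · exact ⟨-1, by simp, hx.symm⟩
  · exact ⟨1, by simp, hx.symm⟩

lemma endpoints_false (h : TwoBranched e f p) (w : List Bool) :
    lo f (false :: w) = branch f false (lo f w) ∧
      hi f (false :: w) = branch f false (hi f w) := by
  have h1 := h.gw_mem w (x := -1) (by simp)
  have h2 := h.gw_mem w (x := 1) (by simp)
  exact ⟨(h.branch_strictMonoOn.monotoneOn.map_min h1 h2).symm,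
    (h.branch_strictMonoOn.monotoneOn.map_max h1 h2).symm⟩

lemma endpoints_true (h : TwoBranched e f p) (w : List Bool) :
    lo f (true :: w) = branch f true (hi f w) ∧ hi f (true :: w) = branch f true (lo f w) := by
  have h1 := h.gw_mem w (x := -1) (by simp)
  have h2 := h.gw_mem w (x := 1) (by simp)
  exact ⟨(h.branch_strictAntiOn.antitoneOn.map_max h1 h2).symm,
    (h.branch_strictAntiOn.antitoneOn.map_min h1 h2).symm⟩

/-- The interval of `b :: w` in the coordinate `t = |x|` is `[s, t]`. -/
lemma exists_endpoints (h : TwoBranched e f p) (b : Bool) (w : List Bool) :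
    ∃ s t : ℝ, 0 ≤ s ∧ s < t ∧ t ≤ 1 ∧ p b s = 1 + e - hi f w ∧ p b t = 1 + e - lo f w ∧
      (b = true → lo f (b :: w) = s ∧ hi f (b :: w) = t) ∧
      (b = false → lo f (b :: w) = -t ∧ hi f (b :: w) = -s) ∧
      hi f (b :: w) - lo f (b :: w) = t - s := by
  obtain ⟨s, hs, h1, h2⟩ := h.exists_branch b (h.hi_mem w)
  obtain ⟨t, ht, h3, h4⟩ := h.exists_branch b (h.lo_mem w)
  have hlt := h.lo_lt_hi w
  have hst : s < t := ((h.mono b).lt_iff_lt hs ht).1 (by linarith)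
  refine ⟨s, t, hs.1, hst, ht.2, h2, h4, ?_⟩
  cases b
  · obtain ⟨h5, h6⟩ := h.endpoints_false w
    rw [h5, h6, h1, h3]
    simp [letterSign]
    ring
  · obtain ⟨h5, h6⟩ := h.endpoints_true w
    rw [h5, h6, h1, h3]
    simp [letterSign]

lemma subset_Iw (h : TwoBranched e f p) (w : List Bool) : Icc (lo f w) (hi f w) ⊆ Iw f w := by
  induction w with
  | nil => simp [lo, hi, Iw, gw]
  | cons b w ih =>
    intro z hz
    obtain ⟨s, t, hs0, hst, ht1, hps, hpt, htrue, hfalse, -⟩ := h.exists_endpoints b w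
    have hz' : ∃ u ∈ Icc s t, z = letterSign b * u := by
      cases b
      · rw [(hfalse rfl).1, (hfalse rfl).2] at hz
        exact ⟨-z, ⟨by linarith [hz.2], by linarith [hz.1]⟩, by simp [letterSign]⟩
      · rw [(htrue rfl).1, (htrue rfl).2] at hz
        exact ⟨z, hz, by simp [letterSign]⟩
    obtain ⟨u, hu, rfl⟩ := hz'
    have hu1 : u ∈ Icc (0:ℝ) 1 := ⟨hs0.trans hu.1, hu.2.trans ht1⟩
    have hfu := h.map_eq b u hu1
    have h1 := (h.mono b).monotoneOn ⟨hs0, hst.le.trans ht1⟩ hu1 hu.1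
    have h2 := (h.mono b).monotoneOn hu1 ⟨hs0.trans hst.le, ht1⟩ hu.2
    have hmem : f (letterSign b * u) ∈ Icc (lo f w) (hi f w) := by
      rw [hfu]; constructor <;> linarith
    obtain ⟨x, hx, hgx⟩ := ih hmem
    refine ⟨x, hx, ?_⟩
    show branch f b (gw f w x) = _
    rw [hgx]
    exact h.branch_eq b hu1 ⟨(h.lo_mem w).1.trans hmem.1, hmem.2.trans (h.hi_mem w).2⟩

lemma Iw_eq (h : TwoBranched e f p) (w : List Bool) : Iw f w = Icc (lo f w) (hi f w) := by
  refine Subset.antisymm ?_ (h.subset_Iw w)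
  rintro _ ⟨x, hx, rfl⟩
  exact h.gw_mem_Icc w hx

lemma len_Iw (h : TwoBranched e f p) (w : List Bool) : len (Iw f w) = hi f w - lo f w := by
  rw [len, h.Iw_eq, Real.volume_Icc, ENNReal.toReal_ofReal (sub_pos.2 (h.lo_lt_hi w)).le]

lemma hi_sub_lo (f : ℝ → ℝ) (w : List Bool) :
    hi f w - lo f w = |gw f w 1 - gw f w (-1)| := max_sub_min_eq_abs _ _

lemma gw_append (f : ℝ → ℝ) (v w : List Bool) (x : ℝ) : gw f (v ++ w) x = gw f v (gw f w x) := by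
  induction v with
  | nil => rfl
  | cons b v ih => simp only [List.cons_append, gw, Function.comp_apply, ih]

lemma branch_neg_one (h : TwoBranched e f p) (b : Bool) : branch f b (-1) = letterSign b := by
  have h1 : f (letterSign b * 1) = -1 := by
    rw [h.map_eq b 1 (by simp), h.map_one]; ring
  have := h.branch_eq b (t := 1) (by simp) (by rw [h1]; simp)
  rwa [h1, mul_one] at this

end TwoBranched

/-- `θ ^ n`, where `n` is the length of what follows the first `true` in a word, and `1` if
there is no `true`. -/
def tauWeight (θ : ℝ) : List Bool → ℝ
  | [] => 1
  | false :: w => tauWeight θ w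
  | true :: w => θ ^ w.length

/-- The weight charged when a letter is put in front of a word starting with `true`. -/
def pendingWeight (θ : ℝ) : List Bool → ℝ
  | [] => 0
  | false :: _ => 0
  | true :: w => tauWeight θ w

lemma tauWeight_nonneg {θ : ℝ} (hθ : 0 ≤ θ) (w : List Bool) : 0 ≤ tauWeight θ w := by
  induction w with
  | nil => exact zero_le_one
  | cons b w ih => cases b; exacts [ih, pow_nonneg hθ _]

lemma pendingWeight_nonneg {θ : ℝ} (hθ : 0 ≤ θ) (w : List Bool) : 0 ≤ pendingWeight θ w := by
  rcases w with _ | ⟨_ | _, w⟩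
  exacts [le_rfl, le_rfl, tauWeight_nonneg hθ w]

lemma tauWeight_eq_one_or (θ : ℝ) (w : List Bool) :
    tauWeight θ w = 1 ∨ ∃ n u, w = List.replicate n false ++ true :: u ∧
      tauWeight θ w = θ ^ u.length := by
  induction w with
  | nil => exact Or.inl rfl
  | cons b w ih =>
    cases b
    · rcases ih with ih | ⟨n, u, rfl, hu⟩
      · exact Or.inl ih
      · exact Or.inr ⟨n + 1, u, by simp [List.replicate_succ], hu⟩
    · exact Or.inr ⟨0, w, rfl, rfl⟩

lemma sum_pow_le {θ : ℝ} (h0 : 0 ≤ θ) (h1 : θ < 1) (n : ℕ) :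
    ∑ k ∈ Finset.range n, θ ^ k ≤ (1 - θ)⁻¹ := by
  rw [← tsum_geometric_of_lt_one h0 h1]
  exact (summable_geometric_of_lt_one h0 h1).sum_le_tsum _ fun _ _ => pow_nonneg h0 _

/-- A two-branched map with power law profiles and exponentially shrinking partitions. -/
structure ControlledSystem (γ m M K α C θ e : ℝ) (f : ℝ → ℝ) (p p' : Bool → ℝ → ℝ) : Prop
    extends TwoBranched e f p where
  prof : ∀ b, PowerProfile γ m M K α (p b) (p' b)
  C_pos : 0 < C
  θ_pos : 0 < θ
  θ_lt : θ < 1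
  decay : ∀ w, hi f w - lo f w ≤ C * θ ^ w.length
  decay_rpow : ∀ w, (hi f w - lo f w) ^ α ≤ C * θ ^ w.length

namespace ControlledSystem

open PowerProfile

variable {γ m M K α C θ e : ℝ} {f : ℝ → ℝ} {p p' : Bool → ℝ → ℝ}

lemma lo_replicate (h : ControlledSystem γ m M K α C θ e f p p') (n : ℕ) :
    lo f (List.replicate n false) = -1 := by
  induction n with
  | zero => simp [lo, gw]
  | succ n ih =>
    rw [List.replicate_succ, (h.endpoints_false _).1, ih, h.branch_neg_one]
    rfl

lemma endpoint_bound_run (h : ControlledSystem γ m M K α C θ e f p p') (n : ℕ) (u : List Bool) :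
    hi f (List.replicate n false ++ true :: u) - lo f (List.replicate n false ++ true :: u) ≤
      2 * C * θ ^ u.length *
        Real.exp (endConst γ m M K * C * ∑ k ∈ Finset.range n, θ ^ (k + 1)) *
        (1 + lo f (List.replicate n false ++ true :: u)) := by
  have hC := h.C_pos
  have hθ := h.θ_pos
  have hpow (j : ℕ) : θ ^ (u.length + j) ≤ θ ^ u.length :=
    pow_le_pow_of_le_one hθ.le h.θ_lt.le (Nat.le_add_right _ _)
  have hE := (h.prof false).endConst_nonneg
  induction n with
  | zero =>
    obtain ⟨s, t, hs, hst, ht, -, -, htrue, -, hl⟩ := h.exists_endpoints true u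
    have h1 := h.decay (true :: u)
    have h2 := hpow 1
    have h3 : 0 < θ ^ u.length := by positivity
    simp only [List.replicate_zero, List.nil_append, Finset.range_zero, Finset.sum_empty, mul_zero,
      Real.exp_zero, mul_one, (htrue rfl).1]
    rw [(htrue rfl).1, List.length_cons] at h1
    have h4 := mul_le_mul_of_nonneg_left h2 hC.le
    have h5 : 0 ≤ C * θ ^ u.length * (1 + 2 * s) := by positivity
    linarith
  | succ n ih =>
    set v := List.replicate n false ++ true :: u with hv
    have hcons : List.replicate (n + 1) false ++ true :: u = false :: v := by
      simp [hv, List.replicate_succ]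
    rw [hcons]
    obtain ⟨s, t, hs, hst, ht, hps, hpt, -, hfalse, hl⟩ := h.exists_endpoints false v
    obtain ⟨h5, h6⟩ := hfalse rfl
    rw [hl, h5]
    set S := ∑ k ∈ Finset.range n, θ ^ (k + 1) with hS
    have hexp : Real.exp (endConst γ m M K * C * ∑ k ∈ Finset.range (n + 1), θ ^ (k + 1)) =
        Real.exp (endConst γ m M K * C * S) *
          Real.exp (endConst γ m M K * (C * θ ^ (n + 1))) := by
      rw [Finset.sum_range_succ, ← Real.exp_add]
      congr 1
      ring
    have hS0 : 0 ≤ S := Finset.sum_nonneg fun _ _ => by positivity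
    by_cases ht2 : t ≤ 1 / 2
    · have h1 := h.decay (false :: v)
      have h2 : θ ^ (false :: v).length ≤ θ ^ u.length :=
        pow_le_pow_of_le_one hθ.le h.θ_lt.le (by simp [hv]; omega)
      have h3 : 1 ≤ Real.exp (endConst γ m M K * C *
          ∑ k ∈ Finset.range (n + 1), θ ^ (k + 1)) := by
        refine Real.one_le_exp (mul_nonneg (mul_nonneg hE hC.le) ?_)
        exact Finset.sum_nonneg fun _ _ => by positivity
      rw [hl] at h1
      have h4 : 0 < C * θ ^ u.length := by positivity
      have h7 := mul_le_mul_of_nonneg_left h2 hC.le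
      have h8 : 1 ≤ Real.exp (endConst γ m M K * C *
          ∑ k ∈ Finset.range (n + 1), θ ^ (k + 1)) * (2 * (1 - t)) :=
        one_le_mul_of_one_le_of_one_le h3 (by linarith)
      nlinarith
    · push Not at ht2
      have hd : 1 - s ≤ hi f (List.replicate (n + 1) false) -
          lo f (List.replicate (n + 1) false) := by
        obtain ⟨x, hx, hgx⟩ := TwoBranched.exists_hi_eq f (false :: v)
        rw [← hcons, TwoBranched.gw_append, hcons, h6] at hgx
        have := (h.gw_mem_Icc (List.replicate (n + 1) false) (h.gw_mem (true :: u) hx)).2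
        rw [h.lo_replicate]
        linarith
      have h1 := (h.prof false).fine_end hs hst.le ht ht2.le hd
      rw [h.map_one, hps, hpt] at h1
      have h2 := h.decay_rpow (List.replicate (n + 1) false)
      rw [List.length_replicate] at h2
      have h3 := Real.add_one_le_exp (endConst γ m M K * (C * θ ^ (n + 1)))
      set Z := (hi f (List.replicate (n + 1) false) - lo f (List.replicate (n + 1) false)) ^ α
      have h4 := mul_le_mul_of_nonneg_left h2 hE
      have hpos : 0 < hi f v - lo f v := sub_pos.2 (h.lo_lt_hi v)
      have ht0 : 0 ≤ 1 - t := by linarith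
      set X := 2 * C * θ ^ u.length * Real.exp (endConst γ m M K * C * S) with hX
      have hX0 : 0 < X := by positivity
      have hlo : 0 < 1 + lo f v := by
        by_contra! hc
        nlinarith
      set Y := Real.exp (endConst γ m M K * (C * θ ^ (n + 1))) with hY
      have hY0 : 0 < Y := Real.exp_pos _
      have h8 : (t - s) * (1 + lo f v) ≤ (X * Y * (1 - t)) * (1 + lo f v) := by
        calc (t - s) * (1 + lo f v) ≤ _ := le_of_eq_of_le (by ring) h1
          _ ≤ Y * (hi f v - lo f v) * (1 - t) := by
            refine mul_le_mul_of_nonneg_right ?_ ht0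
            refine le_of_eq_of_le (b := (1 + endConst γ m M K * Z) * (hi f v - lo f v))
              (by ring) (mul_le_mul_of_nonneg_right ?_ hpos.le)
            linarith
          _ ≤ Y * (X * (1 + lo f v)) * (1 - t) := by gcongr
          _ = _ := by ring
      have h9 := le_of_mul_le_mul_right h8 hlo
      rw [hexp]
      linarith

/-- The constant bounding the relative size of an interval to its distance from `-1`. -/
noncomputable def runConst (γ m M K C θ : ℝ) : ℝ :=
  2 * C * Real.exp (endConst γ m M K * C * (1 - θ)⁻¹)

lemma runConst_pos (h : ControlledSystem γ m M K α C θ e f p p') :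
    0 < runConst γ m M K C θ := by
  have := h.C_pos
  unfold runConst
  positivity

lemma endpoint_bound (h : ControlledSystem γ m M K α C θ e f p p') (n : ℕ) (u : List Bool) :
    hi f (List.replicate n false ++ true :: u) - lo f (List.replicate n false ++ true :: u) ≤
      runConst γ m M K C θ * θ ^ u.length *
        (1 + lo f (List.replicate n false ++ true :: u)) := by
  refine (h.endpoint_bound_run n u).trans ?_
  have h1 : ∑ k ∈ Finset.range n, θ ^ (k + 1) ≤ (1 - θ)⁻¹ := by
    refine le_trans (Finset.sum_le_sum fun k _ => ?_) (sum_pow_le h.θ_pos.le h.θ_lt n)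
    exact pow_le_pow_of_le_one h.θ_pos.le h.θ_lt.le (Nat.le_succ k)
  have h2 : 0 ≤ 1 + lo f (List.replicate n false ++ true :: u) := by
    linarith [(h.lo_mem (List.replicate n false ++ true :: u)).1]
  have h3 := h.C_pos
  have h4 := h.θ_pos
  have h5 := (h.prof false).endConst_nonneg
  calc _ ≤ 2 * C * θ ^ u.length * Real.exp (endConst γ m M K * C * (1 - θ)⁻¹) *
        (1 + lo f (List.replicate n false ++ true :: u)) := by gcongr
    _ = _ := by unfold runConst; ring

/-- The constant bounding the relative size of an interval to its distance from `1`. -/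
noncomputable def topConst (γ m M K C θ : ℝ) : ℝ :=
  2 * C + crude γ m M * 2 ^ (γ - 1) * runConst γ m M K C θ

lemma topConst_nonneg (h : ControlledSystem γ m M K α C θ e f p p') :
    0 ≤ topConst γ m M K C θ := by
  have h1 := h.C_pos
  have h2 := (h.prof false).crude_pos
  have h3 := h.runConst_pos
  unfold topConst
  positivity

lemma top_bound (h : ControlledSystem γ m M K α C θ e f p p') (w : List Bool) :
    1 ≤ θ ^ w.length + pendingWeight θ w ∨
    hi f w - lo f w ≤ topConst γ m M K C θ * (θ ^ w.length + pendingWeight θ w) *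
      (1 - hi f w) := by
  have h1 := h.C_pos
  have h2 := (h.prof false).crude_pos
  have h3 := h.runConst_pos
  have h4 := h.θ_pos
  rcases w with _ | ⟨_ | _, u⟩
  · left
    simp [pendingWeight]
  · right
    obtain ⟨s, t, hs, hst, ht, -, -, -, hfalse, hl⟩ := h.exists_endpoints false u
    refine (h.decay _).trans ?_
    rw [(hfalse rfl).2, pendingWeight, add_zero]
    have : C ≤ topConst γ m M K C θ := by
      have : 0 < C + crude γ m M * 2 ^ (γ - 1) * runConst γ m M K C θ := by positivity
      unfold topConst
      linarith
    calc C * θ ^ (false :: u).length ≤ topConst γ m M K C θ * θ ^ (false :: u).length := by gcongr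
      _ ≤ _ := le_mul_of_one_le_right (mul_nonneg h.topConst_nonneg (by positivity)) (by linarith)
  · rcases tauWeight_eq_one_or θ u with hu | ⟨n, v, hu, hτ⟩
    · left
      rw [pendingWeight, hu]
      have : 0 < θ ^ (true :: u).length := by positivity
      linarith
    right
    obtain ⟨s, t, hs, hst, ht, hps, hpt, htrue, -, hl⟩ := h.exists_endpoints true u
    have h5 := h.decay (true :: u)
    rw [hl] at h5 ⊢
    rw [(htrue rfl).2, pendingWeight, hτ]
    set A := θ ^ (true :: u).length with hA
    have hA0 : 0 < A := by positivity
    set B := θ ^ v.length with hB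
    have hB0 : 0 < B := by positivity
    set L := crude γ m M * 2 ^ (γ - 1) with hL
    have hL0 : 0 < L := by positivity
    by_cases ht2 : t ≤ 1 / 2
    · have h6 : 2 * C * A ≤ topConst γ m M K C θ * (A + B) := by
        rw [topConst, ← hL]
        have : 0 < 2 * C * B + L * runConst γ m M K C θ * (A + B) := by positivity
        linarith
      have h7 := mul_le_mul_of_nonneg_right h6 (show 0 ≤ 1 - t by linarith)
      have h8 : C * A * 1 ≤ C * A * (2 * (1 - t)) := by gcongr; linarith
      linarith
    · push Not at ht2
      have h6 := (h.prof true).crude_end hs hst.le ht ht2.le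
      rw [h.map_one, hps, hpt, ← hL] at h6
      have h7 := h.endpoint_bound n v
      rw [← hu, ← hB] at h7
      have hpos : 0 < hi f u - lo f u := sub_pos.2 (h.lo_lt_hi u)
      have hlo : 0 < 1 + lo f u := by
        by_contra! hc
        have : 0 < runConst γ m M K C θ * B := by positivity
        nlinarith
      have ht0 : 0 ≤ 1 - t := by linarith
      have h8 : (t - s) * (1 + lo f u) ≤ L * runConst γ m M K C θ * B * (1 - t) * (1 + lo f u) := by
        calc (t - s) * (1 + lo f u) ≤ L * (hi f u - lo f u) * (1 - t) := by
              convert h6 using 2 <;> ring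
          _ ≤ L * (runConst γ m M K C θ * B * (1 + lo f u)) * (1 - t) := by gcongr
          _ = _ := by ring
      refine (le_of_mul_le_mul_right h8 hlo).trans (mul_le_mul_of_nonneg_right ?_ ht0)
      rw [topConst, ← hL]
      have : 0 < 2 * C * (A + B) + L * runConst γ m M K C θ * A := by positivity
      linarith

/-- The constant governing the distortion of one inverse branch. -/
noncomputable def stepConst (γ m M K C θ : ℝ) : ℝ :=
  Real.log (crude γ m M) + K / m * C + (γ - 1) * (crude γ m M * topConst γ m M K C θ)

lemma stepConst_nonneg (h : ControlledSystem γ m M K α C θ e f p p') :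
    0 ≤ stepConst γ m M K C θ := by
  have h1 := h.C_pos
  have h2 := (h.prof false).crude_pos
  have h3 := h.topConst_nonneg
  have h4 := (h.prof false).m_pos
  have h5 := (h.prof false).K_nonneg
  have h6 := (h.prof false).one_lt
  have h7 := Real.log_nonneg (h.prof false).one_le_crude
  have h8 : 0 ≤ γ - 1 := by linarith
  unfold stepConst
  positivity

lemma step_distortion (h : ControlledSystem γ m M K α C θ e f p p') (b : Bool) (w : List Bool)
    {x y : ℝ} (hx : x ∈ Icc (-1:ℝ) 1) (hy : y ∈ Icc (-1:ℝ) 1) :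
    |gw f w x - gw f w y| * (hi f (b :: w) - lo f (b :: w)) ≤
      Real.exp (stepConst γ m M K C θ * (θ ^ w.length + pendingWeight θ w)) *
        (hi f w - lo f w) * |gw f (b :: w) x - gw f (b :: w) y| := by
  wlog hxy : gw f w y ≤ gw f w x generalizing x y
  · rw [abs_sub_comm (gw f w x), abs_sub_comm (gw f (b :: w) x)]
    exact this hy hx (le_of_not_ge hxy)
  obtain ⟨s, t, hs, hst, ht, hps, hpt, -, -, hl⟩ := h.exists_endpoints b w
  obtain ⟨u, hu, hgu, hpu⟩ := h.exists_branch b (h.gw_mem w hx)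
  obtain ⟨v, hv, hgv, hpv⟩ := h.exists_branch b (h.gw_mem w hy)
  have hxI := h.gw_mem_Icc w hx
  have hyI := h.gw_mem_Icc w hy
  have hsu : s ≤ u := ((h.mono b).le_iff_le ⟨hs, by linarith⟩ hu).1 (by linarith [hxI.2])
  have huv : u ≤ v := ((h.mono b).le_iff_le hu hv).1 (by linarith)
  have hvt : v ≤ t := ((h.mono b).le_iff_le hv ⟨by linarith, ht⟩).1 (by linarith [hyI.1])
  have habs : |gw f (b :: w) x - gw f (b :: w) y| = v - u := by
    change |branch f b (gw f w x) - branch f b (gw f w y)| = _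
    rw [hgu, hgv, ← mul_sub, abs_mul, abs_letterSign, one_mul, abs_sub_comm,
      abs_of_nonneg (by linarith)]
  rw [habs, hl, abs_of_nonneg (by linarith)]
  have hd1 : gw f w x - gw f w y = p b v - p b u := by linarith
  have hd2 : hi f w - lo f w = p b t - p b s := by linarith
  have hW : 0 ≤ θ ^ w.length + pendingWeight θ w :=
    add_nonneg (pow_nonneg h.θ_pos.le _) (pendingWeight_nonneg h.θ_pos.le w)
  set W := θ ^ w.length + pendingWeight θ w with hWdef
  have hC := h.C_pos
  have hcr := (h.prof b).crude_pos
  have hlog := Real.log_nonneg (h.prof b).one_le_crude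
  have htop := h.topConst_nonneg
  have hm := (h.prof b).m_pos
  have hK := (h.prof b).K_nonneg
  have hγ : 0 ≤ γ - 1 := by linarith [(h.prof b).one_lt]
  have hpos : 0 < hi f w - lo f w := sub_pos.2 (h.lo_lt_hi w)
  have hvu : 0 ≤ v - u := by linarith
  rcases h.top_bound w with hw | hw
  · have h1 := (h.prof b).crude_distortion hs ht hsu huv hvt
    rw [← hd1, ← hd2] at h1
    refine h1.trans ?_
    have h2 : crude γ m M ≤ Real.exp (stepConst γ m M K C θ * W) := by
      rw [← Real.log_le_iff_le_exp hcr]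
      have h3 : stepConst γ m M K C θ * 1 ≤ stepConst γ m M K C θ * W :=
        mul_le_mul_of_nonneg_left hw h.stepConst_nonneg
      have h4 : 0 ≤ K / m * C + (γ - 1) * (crude γ m M * topConst γ m M K C θ) := by positivity
      have h5 : stepConst γ m M K C θ = Real.log (crude γ m M) +
        (K / m * C + (γ - 1) * (crude γ m M * topConst γ m M K C θ)) := by
          unfold stepConst; ring
      linarith
    gcongr
  · have hTW : 0 ≤ topConst γ m M K C θ * W := mul_nonneg htop hW
    have h1 := (h.prof b).sub_le_mul_of_le (h.map_zero b) hs hst ht hTW (by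
      rw [← hd2, hps]
      exact hw.trans (mul_le_mul_of_nonneg_left (by linarith [h.e_nonneg]) hTW))
    have hs0 : 0 < s := by
      rcases hs.eq_or_lt with rfl | hs
      · simp only [mul_zero] at h1; linarith
      · exact hs
    have h2 := (h.prof b).fine_distortion hs0 ht hsu huv hvt h1
    rw [← hd1, ← hd2] at h2
    refine h2.trans ?_
    have h3 := h.decay_rpow (b :: w)
    rw [hl] at h3
    have h4 : θ ^ (b :: w).length ≤ W := by
      have h5 : θ ^ (b :: w).length ≤ θ ^ w.length :=
        pow_le_pow_of_le_one h.θ_pos.le h.θ_lt.le (by simp)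
      linarith [pendingWeight_nonneg h.θ_pos.le w]
    have h6 : K / m * (t - s) ^ α + (γ - 1) * (crude γ m M * (topConst γ m M K C θ * W)) ≤
        stepConst γ m M K C θ * W := by
      have h7 : K / m * (t - s) ^ α ≤ K / m * (C * W) := by
        refine mul_le_mul_of_nonneg_left (h3.trans ?_) (by positivity)
        gcongr
      have h8 : 0 ≤ Real.log (crude γ m M) * W := by positivity
      unfold stepConst
      linarith
    rw [← mul_assoc (crude γ m M)] at h6
    have h9 := Real.exp_le_exp.2 h6
    rw [mul_assoc (crude γ m M)] at h9
    gcongr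

lemma weight_step (θ : ℝ) (hθ : 0 ≤ θ) (b : Bool) (w : List Bool) :
    tauWeight θ (b :: w) + pendingWeight θ (b :: w) ≤ θ ^ w.length + tauWeight θ w := by
  cases b
  · simpa [tauWeight, pendingWeight] using pow_nonneg hθ _
  · simp [tauWeight, pendingWeight]

lemma distortion_weighted (h : ControlledSystem γ m M K α C θ e f p p') (w : List Bool)
    {x y : ℝ} (hx : x ∈ Icc (-1:ℝ) 1) (hy : y ∈ Icc (-1:ℝ) 1) :
    (hi f w - lo f w) * |x - y| ≤ 2 * Real.exp (stepConst γ m M K C θ *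
      (2 * ∑ k ∈ Finset.range w.length, θ ^ k + 2 - tauWeight θ w - pendingWeight θ w)) *
        |gw f w x - gw f w y| := by
  have hK := h.stepConst_nonneg
  induction w with
  | nil =>
    have : hi f [] - lo f [] = 2 := by norm_num [hi, lo, gw]
    rw [this]
    simp only [tauWeight, pendingWeight, gw, id]
    refine mul_le_mul_of_nonneg_right (le_mul_of_one_le_right (by norm_num)
      (Real.one_le_exp (mul_nonneg hK ?_))) (abs_nonneg _)
    norm_num
  | cons b w ih =>
    have hpos : 0 < hi f w - lo f w := sub_pos.2 (h.lo_lt_hi w)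
    have hpos' : 0 < hi f (b :: w) - lo f (b :: w) := sub_pos.2 (h.lo_lt_hi _)
    have h1 := h.step_distortion b w hx hy
    set R := 2 * ∑ k ∈ Finset.range w.length, θ ^ k + 2 - tauWeight θ w - pendingWeight θ w with hR
    set R' := 2 * ∑ k ∈ Finset.range (b :: w).length, θ ^ k + 2 - tauWeight θ (b :: w) -
      pendingWeight θ (b :: w) with hR'
    have hRR : R + (θ ^ w.length + pendingWeight θ w) ≤ R' := by
      have := weight_step θ h.θ_pos.le b w
      rw [hR, hR', List.length_cons, Finset.sum_range_succ]
      linarith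
    have hexp : Real.exp (stepConst γ m M K C θ * R) *
        Real.exp (stepConst γ m M K C θ * (θ ^ w.length + pendingWeight θ w)) ≤
        Real.exp (stepConst γ m M K C θ * R') := by
      rw [← Real.exp_add, ← mul_add]
      exact Real.exp_le_exp.2 (mul_le_mul_of_nonneg_left hRR hK)
    refine le_of_mul_le_mul_right ?_ hpos
    calc (hi f (b :: w) - lo f (b :: w)) * |x - y| * (hi f w - lo f w)
        = (hi f w - lo f w) * |x - y| * (hi f (b :: w) - lo f (b :: w)) := by ring
      _ ≤ 2 * Real.exp (stepConst γ m M K C θ * R) * |gw f w x - gw f w y| *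
          (hi f (b :: w) - lo f (b :: w)) := mul_le_mul_of_nonneg_right ih hpos'.le
      _ = 2 * Real.exp (stepConst γ m M K C θ * R) * (|gw f w x - gw f w y| *
          (hi f (b :: w) - lo f (b :: w))) := by ring
      _ ≤ 2 * Real.exp (stepConst γ m M K C θ * R) *
          (Real.exp (stepConst γ m M K C θ * (θ ^ w.length + pendingWeight θ w)) *
          (hi f w - lo f w) * |gw f (b :: w) x - gw f (b :: w) y|) :=
        mul_le_mul_of_nonneg_left h1 (by positivity)
      _ = 2 * (Real.exp (stepConst γ m M K C θ * R) *
          Real.exp (stepConst γ m M K C θ * (θ ^ w.length + pendingWeight θ w))) *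
          |gw f (b :: w) x - gw f (b :: w) y| * (hi f w - lo f w) := by ring
      _ ≤ _ := by gcongr

/-- The uniform distortion constant. -/
noncomputable def distConst (γ m M K C θ : ℝ) : ℝ :=
  2 * Real.exp (stepConst γ m M K C θ * (2 * (1 - θ)⁻¹ + 2))

/-- Relative lengths shrink at most by a uniform factor under inverse branches. -/
lemma distortion (h : ControlledSystem γ m M K α C θ e f p p') (w : List Bool)
    {x y : ℝ} (hx : x ∈ Icc (-1:ℝ) 1) (hy : y ∈ Icc (-1:ℝ) 1) :
    (hi f w - lo f w) * |x - y| ≤ distConst γ m M K C θ * |gw f w x - gw f w y| := by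
  refine (h.distortion_weighted w hx hy).trans (mul_le_mul_of_nonneg_right
    (mul_le_mul_of_nonneg_left (Real.exp_le_exp.2 (mul_le_mul_of_nonneg_left ?_
      h.stepConst_nonneg)) (by norm_num)) (abs_nonneg _))
  linarith [sum_pow_le h.θ_pos.le h.θ_lt w.length, tauWeight_nonneg h.θ_pos.le w,
    pendingWeight_nonneg h.θ_pos.le w]

end ControlledSystem

lemma rpow_add_rpow_le {q r T δ : ℝ} (hq : 0 ≤ q) (hr : 0 ≤ r) (hT : 0 ≤ T) (h0 : 0 ≤ δ)
    (h1 : δ ≤ 1) (h : q + r ≤ (1 - δ) * T) :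
    q ^ (1 - δ / 2) + r ^ (1 - δ / 2) ≤ T ^ (1 - δ / 2) := by
  set s := 1 - δ / 2 with hs
  have hs0 : 0 < s := by linarith
  have hconc := (Real.concaveOn_rpow hs0.le (by linarith : s ≤ 1)).2 (mem_Ici.2 hq) (mem_Ici.2 hr)
    (by norm_num : (0:ℝ) ≤ 1 / 2) (by norm_num : (0:ℝ) ≤ 1 / 2) (by norm_num)
  simp only [smul_eq_mul] at hconc
  have hexp1 : 1 - δ ≤ Real.exp (-δ) := by linarith [Real.add_one_le_exp (-δ)]
  have hexp2 : (2:ℝ) ≤ Real.exp 1 := by linarith [Real.add_one_le_exp (1:ℝ)]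
  have hle : 1 / 2 * q + 1 / 2 * r ≤ Real.exp (-δ) / 2 * T := by nlinarith
  have h2 : (1 / 2 * q + 1 / 2 * r) ^ s ≤ (Real.exp (-δ) / 2 * T) ^ s :=
    Real.rpow_le_rpow (by positivity) hle hs0.le
  rw [Real.mul_rpow (by positivity) hT, Real.div_rpow (by positivity) (by norm_num),
    ← Real.exp_mul] at h2
  have h3 : 2 * (Real.exp (-δ * s) / 2 ^ s) ≤ 1 := by
    have h4 : (2:ℝ) = 2 ^ s * 2 ^ (1 - s) := by
      rw [← Real.rpow_add (by norm_num)]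
      simp
    have h5 : (2:ℝ) ^ (1 - s) ≤ Real.exp (1 - s) := by
      refine (Real.rpow_le_rpow (by norm_num) hexp2 (by linarith)).trans ?_
      rw [← Real.exp_mul, one_mul]
    have h6 : Real.exp (1 - s) * Real.exp (-δ * s) ≤ 1 := by
      rw [← Real.exp_add, Real.exp_le_one_iff]
      nlinarith
    have h7 : 0 < (2:ℝ) ^ s := Real.rpow_pos_of_pos (by norm_num) _
    have h8 := Real.exp_pos (-δ * s)
    rw [← mul_div_assoc, div_le_one h7]
    calc 2 * Real.exp (-δ * s) = 2 ^ s * (2 ^ (1 - s) * Real.exp (-δ * s)) := by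
          rw [← mul_assoc, ← h4]
      _ ≤ 2 ^ s * (Real.exp (1 - s) * Real.exp (-δ * s)) := by gcongr
      _ ≤ 2 ^ s * 1 := by gcongr
      _ = 2 ^ s := mul_one _
  have h9 := mul_le_mul_of_nonneg_right h3 (Real.rpow_nonneg hT s)
  linarith

namespace TwoBranched

variable {e : ℝ} {f : ℝ → ℝ} {p : Bool → ℝ → ℝ}

lemma mem_Iw_cons (h : TwoBranched e f p) {x : ℝ} (hx : x ∈ Icc (-1:ℝ) 1) {w : List Bool}
    (hf : f x ∈ Iw f w) : ∃ b, x ∈ Iw f (b :: w) := by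
  have hfx : f x ∈ Icc (-1:ℝ) 1 := by
    obtain ⟨z, hz, hzx⟩ := hf
    rw [← hzx]
    exact h.gw_mem w hz
  have key (b : Bool) (t : ℝ) (ht : t ∈ Icc (0:ℝ) 1) (hxt : x = letterSign b * t) :
      x ∈ Iw f (b :: w) := by
    obtain ⟨z, hz, hzx⟩ := hf
    refine ⟨z, hz, ?_⟩
    change branch f b (gw f w z) = x
    rw [hzx]
    rw [hxt] at hfx ⊢
    exact h.branch_eq b ht hfx
  rcases le_total 0 x with h0 | h0
  · exact ⟨true, key true x ⟨h0, hx.2⟩ (by simp [letterSign])⟩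
  · exact ⟨false, key false (-x) ⟨by linarith, by linarith [hx.1]⟩ (by simp [letterSign])⟩

lemma map_mem_Lambda {x : ℝ} (hx : x ∈ Lambda f) : f x ∈ Lambda f := fun n => by
  rw [← Function.iterate_succ_apply]
  exact hx (n + 1)

lemma exists_mem_Iw (h : TwoBranched e f p) (n : ℕ) {x : ℝ} (hx : x ∈ Lambda f) :
    ∃ a : Fin n → Bool, x ∈ Iw f (List.ofFn a) := by
  induction n generalizing x with
  | zero => exact ⟨Fin.elim0, by simpa [Iw, gw] using hx 0⟩
  | succ n ih =>
    obtain ⟨a, ha⟩ := ih (map_mem_Lambda hx)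
    obtain ⟨b, hb⟩ := h.mem_Iw_cons (hx 0) ha
    exact ⟨Fin.cons b a, by rwa [List.ofFn_cons]⟩

/-- The two children of an interval and the gap between them fill it. -/
lemma children_add_gap (h : TwoBranched e f p) (w : List Bool) :
    (hi f (w ++ [false]) - lo f (w ++ [false])) + (hi f (w ++ [true]) - lo f (w ++ [true])) +
      |gw f w (branch f true 1) - gw f w (branch f false 1)| = hi f w - lo f w := by
  simp only [hi_sub_lo, gw_append]
  change |gw f w (branch f false 1) - gw f w (branch f false (-1))| +
    |gw f w (branch f true 1) - gw f w (branch f true (-1))| + _ = _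
  rw [h.branch_neg_one, h.branch_neg_one]
  have h1 := h.branch_mem false (y := 1) (by simp)
  have h2 := h.branch_mem true (y := 1) (by simp)
  have hle : branch f false 1 ≤ branch f true 1 := by
    obtain ⟨s, hs, hs1, -⟩ := h.exists_branch false (y := 1) (by simp)
    obtain ⟨t, ht, ht1, -⟩ := h.exists_branch true (y := 1) (by simp)
    rw [hs1, ht1]
    simp only [letterSign]
    linarith [hs.1, ht.1]
  simp only [letterSign]
  rcases h.gw_mono_or_anti w with hw | hw
  · have i1 := hw.monotoneOn (by simp) h1 h1.1
    have i2 := hw.monotoneOn h1 h2 hle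
    have i3 := hw.monotoneOn h2 (by simp) h2.2
    rw [abs_of_nonneg (by linarith), abs_of_nonpos (by linarith), abs_of_nonneg (by linarith),
      abs_of_nonneg (by linarith)]
    ring
  · have i1 := hw.antitoneOn (by simp) h1 h1.1
    have i2 := hw.antitoneOn h1 h2 hle
    have i3 := hw.antitoneOn h2 (by simp) h2.2
    rw [abs_of_nonpos (by linarith), abs_of_nonneg (by linarith), abs_of_nonpos (by linarith),
      abs_of_nonpos (by linarith)]
    ring

end TwoBranched

namespace ControlledSystem

variable {γ m M K α C θ e : ℝ} {f : ℝ → ℝ} {p p' : Bool → ℝ → ℝ}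

lemma distConst_pos : 0 < distConst γ m M K C θ := by
  unfold distConst
  positivity

/-- The constant in the lower bound for relative gaps. -/
noncomputable def gapConst (γ m M K C θ : ℝ) : ℝ :=
  (M ^ (1 / γ) * distConst γ m M K C θ)⁻¹

lemma gapConst_pos (hM : 0 < M) : 0 < gapConst γ m M K C θ :=
  inv_pos.2 (mul_pos (Real.rpow_pos_of_pos hM _) distConst_pos)

lemma central_gap (h : ControlledSystem γ m M K α C θ e f p p') :
    e ^ (1 / γ) ≤ M ^ (1 / γ) * |branch f true 1 - branch f false 1| := by
  obtain ⟨s, hs, hs1, hs2⟩ := h.exists_branch false (y := 1) (by simp)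
  obtain ⟨t, ht, ht1, -⟩ := h.exists_branch true (y := 1) (by simp)
  have hM := (h.prof false).M_pos
  have hγ := (h.prof false).one_lt
  rw [hs1, ht1]
  simp only [letterSign]
  rw [abs_of_nonneg (by linarith [hs.1, ht.1])]
  have h1 := (h.prof false).sub_le le_rfl hs.1 hs.2
  rw [hs2, h.map_zero, sub_zero, sub_zero, mul_assoc] at h1
  have h2 : s ^ (γ - 1) * s = s ^ γ := by
    rcases hs.1.eq_or_lt with h0 | h0
    · rw [← h0, mul_zero, Real.zero_rpow (by linarith)]
    · rw [← Real.rpow_add_one h0.ne', sub_add_cancel]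
  rw [h2] at h1
  have h3 : e ^ (1 / γ) ≤ (M * s ^ γ) ^ (1 / γ) :=
    Real.rpow_le_rpow h.e_nonneg (by linarith) (by positivity)
  rw [Real.mul_rpow hM.le (Real.rpow_nonneg hs.1 _), ← Real.rpow_mul hs.1,
    mul_one_div_cancel (by linarith), Real.rpow_one] at h3
  refine h3.trans (mul_le_mul_of_nonneg_left ?_ (Real.rpow_nonneg hM.le _))
  linarith [ht.1]

lemma children_le (h : ControlledSystem γ m M K α C θ e f p p') (w : List Bool) :
    (hi f (w ++ [false]) - lo f (w ++ [false])) + (hi f (w ++ [true]) - lo f (w ++ [true])) ≤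
      (1 - gapConst γ m M K C θ * e ^ (1 / γ)) * (hi f w - lo f w) := by
  have h1 := h.children_add_gap w
  have h2 := h.distortion w (h.branch_mem true (y := 1) (by simp))
    (h.branch_mem false (y := 1) (by simp))
  have h3 := h.central_gap
  have hMγ : 0 < M ^ (1 / γ) := Real.rpow_pos_of_pos (h.prof false).M_pos _
  have hd : 0 < distConst γ m M K C θ := distConst_pos
  have hpos : 0 < hi f w - lo f w := sub_pos.2 (h.lo_lt_hi w)
  have h4 : gapConst γ m M K C θ * e ^ (1 / γ) * (hi f w - lo f w) ≤
      |gw f w (branch f true 1) - gw f w (branch f false 1)| := by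
    rw [gapConst, mul_assoc, inv_mul_le_iff₀ (by positivity)]
    calc e ^ (1 / γ) * (hi f w - lo f w)
        ≤ M ^ (1 / γ) * |branch f true 1 - branch f false 1| * (hi f w - lo f w) := by gcongr
      _ = M ^ (1 / γ) * ((hi f w - lo f w) * |branch f true 1 - branch f false 1|) := by ring
      _ ≤ M ^ (1 / γ) * (distConst γ m M K C θ *
          |gw f w (branch f true 1) - gw f w (branch f false 1)|) := by gcongr
      _ = _ := by ring
  linarith

lemma gap_nonneg (h : ControlledSystem γ m M K α C θ e f p p') :
    0 ≤ gapConst γ m M K C θ * e ^ (1 / γ) :=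
  mul_nonneg (gapConst_pos (h.prof false).M_pos).le (Real.rpow_nonneg h.e_nonneg _)

lemma gap_le_one (h : ControlledSystem γ m M K α C θ e f p p') :
    gapConst γ m M K C θ * e ^ (1 / γ) ≤ 1 := by
  have h1 := h.children_le []
  have h2 := h.lo_lt_hi [false]
  have h3 := h.lo_lt_hi [true]
  have h4 := h.lo_lt_hi []
  simp only [List.nil_append] at h1
  by_contra! hc
  nlinarith

/-- The candidate upper bound for the dimension. -/
noncomputable def dimBound (γ m M K C θ e : ℝ) : ℝ :=
  1 - gapConst γ m M K C θ * e ^ (1 / γ) / 2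

lemma sum_rpow_le (h : ControlledSystem γ m M K α C θ e f p p') (n : ℕ) (v : List Bool) :
    ∑ a : Fin n → Bool, (hi f (v ++ List.ofFn a) - lo f (v ++ List.ofFn a)) ^
      dimBound γ m M K C θ e ≤ (hi f v - lo f v) ^ dimBound γ m M K C θ e := by
  induction n generalizing v with
  | zero => simp
  | succ n ih =>
    rw [← (Fin.consEquiv fun _ : Fin (n + 1) => Bool).sum_comp, Fintype.sum_prod_type,
      Fintype.sum_bool]
    have hcons (b : Bool) (a : Fin n → Bool) :
        v ++ List.ofFn (Fin.consEquiv (fun _ : Fin (n + 1) => Bool) (b, a)) =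
          (v ++ [b]) ++ List.ofFn a := by
      change v ++ List.ofFn (Fin.cons b a : Fin (n + 1) → Bool) = _
      rw [List.ofFn_cons, List.append_assoc, List.singleton_append]
    simp only [hcons]
    refine (add_le_add (ih _) (ih _)).trans ?_
    rw [add_comm]
    exact rpow_add_rpow_le (sub_pos.2 (h.lo_lt_hi _)).le (sub_pos.2 (h.lo_lt_hi _)).le
      (sub_pos.2 (h.lo_lt_hi _)).le h.gap_nonneg h.gap_le_one (h.children_le v)

lemma dimH_Lambda_le (h : ControlledSystem γ m M K α C θ e f p p') :
    dimH (Lambda f) ≤ ENNReal.ofReal (dimBound γ m M K C θ e) := by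
  have hs0 : 0 < dimBound γ m M K C θ e := by
    unfold dimBound
    linarith [h.gap_le_one]
  refine dimH_le_of_hausdorffMeasure_ne_top ?_
  rw [Real.coe_toNNReal _ hs0.le]
  have hdiam (w : List Bool) : Metric.ediam (Iw f w) = ENNReal.ofReal (hi f w - lo f w) := by
    rw [h.Iw_eq, Real.ediam_Icc]
  have hlim : Tendsto (fun n : ℕ => ENNReal.ofReal (C * θ ^ n)) atTop (𝓝 0) := by
    have h1 := (tendsto_pow_atTop_nhds_zero_of_lt_one h.θ_pos.le h.θ_lt).const_mul C
    rw [mul_zero] at h1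
    simpa using ENNReal.tendsto_ofReal h1
  have hH := MeasureTheory.Measure.hausdorffMeasure_le_liminf_sum (dimBound γ m M K C θ e)
    (Lambda f) (fun n : ℕ => ENNReal.ofReal (C * θ ^ n)) hlim
    (fun n (a : Fin n → Bool) => Iw f (List.ofFn a))
    (Eventually.of_forall fun n a => by
      rw [hdiam]
      refine ENNReal.ofReal_le_ofReal ((h.decay _).trans_eq ?_)
      rw [List.length_ofFn])
    (Eventually.of_forall fun n x hx => mem_iUnion.2 (h.exists_mem_Iw n hx))
  refine ne_top_of_le_ne_top (b := ENNReal.ofReal ((hi f [] - lo f []) ^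
    dimBound γ m M K C θ e)) ENNReal.ofReal_ne_top (hH.trans ?_)
  refine (liminf_le_liminf (Eventually.of_forall fun n => ?_)).trans_eq (liminf_const _)
  have h1 := h.sum_rpow_le n []
  simp only [List.nil_append] at h1
  simp only [hdiam]
  refine le_trans (le_of_eq ?_) (ENNReal.ofReal_le_ofReal h1)
  rw [ENNReal.ofReal_sum_of_nonneg fun a _ =>
    Real.rpow_nonneg (sub_pos.2 (h.lo_lt_hi _)).le _]
  exact Finset.sum_congr rfl fun a _ =>
    ENNReal.ofReal_rpow_of_nonneg (sub_pos.2 (h.lo_lt_hi _)).le hs0.le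

end ControlledSystem

/-- The binary number whose digits record on which side of `0` the orbit of `x` lies. -/
noncomputable def itineraryCode (f : ℝ → ℝ) (x : ℝ) : ℝ :=
  Real.ofDigits fun k : ℕ => if 0 < f^[k] x then (1 : Fin 2) else 0

namespace TwoBranched

variable {e : ℝ} {f : ℝ → ℝ} {p : Bool → ℝ → ℝ}

lemma pos_iff_of_mem_Iw (h : TwoBranched e f p) (he : 0 < e) {b : Bool} {w : List Bool} {x : ℝ}
    (hx : x ∈ Iw f (b :: w)) : 0 < x ↔ b = true := by
  obtain ⟨z, hz, rfl⟩ := hx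
  have hgz := h.gw_mem w hz
  obtain ⟨t, ht, h1, h2⟩ := h.exists_branch b hgz
  have ht0 : 0 < t := by
    refine ht.1.lt_of_ne fun h0 => ?_
    rw [← h0, h.map_zero] at h2
    linarith [hgz.2]
  change 0 < branch f b (gw f w z) ↔ _
  rw [h1]
  cases b
  · simp [letterSign, ht0.le]
  · simp [letterSign, ht0]

lemma map_mem_Iw (h : TwoBranched e f p) {b : Bool} {w : List Bool} {x : ℝ}
    (hx : x ∈ Iw f (b :: w)) : f x ∈ Iw f w := by
  obtain ⟨z, hz, rfl⟩ := hx
  refine ⟨z, hz, ?_⟩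
  exact (h.map_branch b (h.gw_mem w hz)).symm

lemma exists_itinerary (h : TwoBranched e f p) (he : 0 < e) (a : ℕ → Bool) :
    ∃ x ∈ Lambda f, ∀ k, 0 < f^[k] x ↔ a k = true := by
  have hne : (⋂ n : ℕ, Iw f (List.ofFn fun i : Fin n => a i)).Nonempty := by
    refine IsCompact.nonempty_iInter_of_sequence_nonempty_isCompact_isClosed _ (fun n => ?_)
      (fun n => ⟨_, 0, by simp, rfl⟩) (by rw [h.Iw_eq]; exact isCompact_Icc)
      (fun n => by rw [h.Iw_eq]; exact isClosed_Icc)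
    rintro _ ⟨z, hz, rfl⟩
    rw [List.ofFn_succ', List.concat_eq_append, gw_append]
    exact ⟨_, h.gw_mem _ hz, rfl⟩
  obtain ⟨x, hx⟩ := hne
  rw [mem_iInter] at hx
  have key (k n : ℕ) : f^[k] x ∈ Iw f (List.ofFn fun i : Fin n => a (i + k)) := by
    induction k generalizing n with
    | zero => exact hx n
    | succ k ih =>
      rw [Function.iterate_succ_apply']
      have h1 := ih (n + 1)
      rw [List.ofFn_succ] at h1
      simpa [add_assoc, add_comm 1 k] using h.map_mem_Iw h1
  refine ⟨x, fun k => by simpa [Iw, gw] using key k 0, fun k => ?_⟩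
  have h1 := key k 1
  rw [List.ofFn_succ] at h1
  simpa using h.pos_iff_of_mem_Iw he h1

lemma Ico_subset_image_code (h : TwoBranched e f p) (he : 0 < e) :
    Ico (0:ℝ) 1 ⊆ itineraryCode f '' Lambda f := by
  intro y hy
  obtain ⟨x, hx, hk⟩ := h.exists_itinerary he fun k => decide (y.digits 2 k = 1)
  refine ⟨x, hx, ?_⟩
  rw [itineraryCode, ← Real.ofDigits_digits (b := 2) (by norm_num) hy]
  congr 1
  funext k
  have := hk k
  rw [decide_eq_true_iff] at this
  split_ifs with h1
  · exact (this.1 h1).symm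
  · have h2 : y.digits 2 k ≠ 1 := fun h3 => h1 (this.2 h3)
    generalize y.digits 2 k = d at h2
    fin_cases d
    · rfl
    · exact absurd rfl h2

/-- If the profiles are `L`-Lipschitz, then so is `f` on each side of `0`. -/
lemma abs_map_sub_le (h : TwoBranched e f p) {L : ℝ}
    (hL : ∀ b, ∀ s t, 0 ≤ s → s ≤ t → t ≤ 1 → p b t - p b s ≤ L * (t - s))
    {x y : ℝ} (hx : x ∈ Icc (-1:ℝ) 1) (hy : y ∈ Icc (-1:ℝ) 1) (hxy : 0 < x ↔ 0 < y) :
    |f x - f y| ≤ L * |x - y| := by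
  have key (b : Bool) (s t : ℝ) (hs : s ∈ Icc (0:ℝ) 1) (ht : t ∈ Icc (0:ℝ) 1) :
      |f (letterSign b * s) - f (letterSign b * t)| ≤
        L * |letterSign b * s - letterSign b * t| := by
    wlog hst : s ≤ t generalizing s t
    · rw [abs_sub_comm, abs_sub_comm (letterSign b * s)]
      exact this t s ht hs (le_of_not_ge hst)
    rw [h.map_eq b s hs, h.map_eq b t ht, ← mul_sub, abs_mul, abs_letterSign, one_mul,
      abs_sub_comm s t, abs_of_nonneg (sub_nonneg.2 hst)]
    have h1 := (h.mono b).monotoneOn hs ht hst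
    rw [abs_of_nonneg (by linarith)]
    linarith [hL b s t hs.1 hst ht.2]
  by_cases h0 : 0 < x
  · simpa [letterSign] using key true x y ⟨h0.le, hx.2⟩ ⟨(hxy.1 h0).le, hy.2⟩
  · have h0' : ¬ 0 < y := fun h1 => h0 (hxy.2 h1)
    push Not at h0 h0'
    simpa [letterSign] using key false (-x) (-y) ⟨by linarith, by linarith [hx.1]⟩
      ⟨by linarith, by linarith [hy.1]⟩

lemma le_mul_abs (h : TwoBranched e f p) {L : ℝ}
    (hL : ∀ b, ∀ s t, 0 ≤ s → s ≤ t → t ≤ 1 → p b t - p b s ≤ L * (t - s))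
    {x : ℝ} (hx : x ∈ Icc (-1:ℝ) 1) (hfx : f x ≤ 1) : e ≤ L * |x| := by
  have key (b : Bool) (t : ℝ) (ht : t ∈ Icc (0:ℝ) 1) (hf : f (letterSign b * t) ≤ 1) :
      e ≤ L * t := by
    rw [h.map_eq b t ht] at hf
    have := hL b 0 t le_rfl ht.1 ht.2
    rw [h.map_zero] at this
    linarith
  rcases le_total 0 x with h0 | h0
  · rw [abs_of_nonneg h0]
    exact key true x ⟨h0, hx.2⟩ (by simpa [letterSign] using hfx)
  · rw [abs_of_nonpos h0]
    exact key false (-x) ⟨by linarith, by linarith [hx.1]⟩ (by simpa [letterSign] using hfx)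

lemma abs_code_sub_le (h : TwoBranched e f p) (he : 0 < e) {L : ℝ} (hL1 : 1 < L)
    (hL : ∀ b, ∀ s t, 0 ≤ s → s ≤ t → t ≤ 1 → p b t - p b s ≤ L * (t - s))
    {x y : ℝ} (hx : x ∈ Lambda f) (hy : y ∈ Lambda f) :
    |itineraryCode f x - itineraryCode f y| ≤
      (L / e * |x - y|) ^ (Real.log 2 / Real.log L) := by
  have hL0 : 0 < L := by linarith
  have hlog : 0 < Real.log L := Real.log_pos hL1
  by_cases hex : ∃ k, ¬ (0 < f^[k] x ↔ 0 < f^[k] y)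
  swap
  · push Not at hex
    have : itineraryCode f x = itineraryCode f y := by
      unfold itineraryCode
      simp only [hex]
    rw [this, sub_self, abs_zero]
    exact Real.rpow_nonneg (by positivity) _
  classical
  set n := Nat.find hex with hn
  have hlt (k : ℕ) (hk : k < n) : 0 < f^[k] x ↔ 0 < f^[k] y := not_not.1 (Nat.find_min hex hk)
  have h1 : |itineraryCode f x - itineraryCode f y| ≤ ((2:ℝ) ^ n)⁻¹ := by
    have := Real.abs_ofDigits_sub_ofDigits_le (b := 2) (n := n)
      (x := fun k : ℕ => if 0 < f^[k] x then (1 : Fin 2) else 0)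
      (y := fun k : ℕ => if 0 < f^[k] y then (1 : Fin 2) else 0)
      (fun i hi => by simp only [hlt i hi])
    exact_mod_cast this
  have h2 (k : ℕ) (hk : k ≤ n) : |f^[k] x - f^[k] y| ≤ L ^ k * |x - y| := by
    induction k with
    | zero => simp
    | succ k ih =>
      rw [Function.iterate_succ_apply', Function.iterate_succ_apply']
      refine (h.abs_map_sub_le hL (hx k) (hy k) (hlt k hk)).trans ?_
      rw [pow_succ', mul_assoc]
      exact mul_le_mul_of_nonneg_left (ih (by omega)) hL0.le
  have h3 : |f^[n] x| ≤ |f^[n] x - f^[n] y| := by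
    have := Nat.find_spec hex
    rw [← hn] at this
    rcases lt_or_ge 0 (f^[n] x) with h4 | h4
    · have h5 : f^[n] y ≤ 0 := by
        by_contra! h5
        exact this ⟨fun _ => h5, fun _ => h4⟩
      rw [abs_of_pos h4, abs_of_nonneg (by linarith)]
      linarith
    · have h5 : 0 < f^[n] y := by
        by_contra! h5
        exact this ⟨fun h6 => absurd h6 h4.not_gt, fun h6 => absurd h6 h5.not_gt⟩
      rw [abs_of_nonpos h4, abs_of_nonpos (by linarith)]
      linarith
  have h4 := h.le_mul_abs hL (hx n) (by
    have := (hx (n + 1)).2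
    rwa [Function.iterate_succ_apply'] at this)
  have h5 : (L ^ n)⁻¹ ≤ L / e * |x - y| := by
    have h6 : e ≤ L * (L ^ n * |x - y|) :=
      h4.trans (mul_le_mul_of_nonneg_left (h3.trans (h2 n le_rfl)) hL0.le)
    rw [inv_le_iff_one_le_mul₀ (by positivity), div_mul_eq_mul_div, div_mul_eq_mul_div,
      one_le_div he]
    linarith
  refine h1.trans (le_trans (le_of_eq ?_)
    (Real.rpow_le_rpow (by positivity) h5 (div_nonneg (Real.log_nonneg one_le_two) hlog.le)))
  rw [Real.inv_rpow (by positivity), ← Real.rpow_natCast L, ← Real.rpow_mul hL0.le, mul_comm,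
    Real.rpow_mul hL0.le, Real.rpow_natCast]
  congr 2
  rw [Real.rpow_def_of_pos hL0, mul_div_cancel₀ _ hlog.ne', Real.exp_log two_pos]

lemma dimH_Lambda_pos_of_pos (h : TwoBranched e f p) (he : 0 < e) {L : ℝ} (hL1 : 1 < L)
    (hL : ∀ b, ∀ s t, 0 ≤ s → s ≤ t → t ≤ 1 → p b t - p b s ≤ L * (t - s)) :
    0 < dimH (Lambda f) := by
  have hlog : 0 < Real.log L := Real.log_pos hL1
  set r : NNReal := ⟨Real.log 2 / Real.log L, (div_pos (Real.log_pos one_lt_two) hlog).le⟩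
  have hr0 : 0 < r := div_pos (Real.log_pos one_lt_two) hlog
  set c : NNReal := ⟨(L / e) ^ (Real.log 2 / Real.log L), Real.rpow_nonneg (by positivity) _⟩
  have hH : HolderOnWith c r (itineraryCode f) (Lambda f) := by
    intro x hx y hy
    rw [edist_dist, edist_dist, Real.dist_eq, Real.dist_eq,
      ENNReal.ofReal_rpow_of_nonneg (abs_nonneg (x - y)) (NNReal.coe_nonneg r),
      ← ENNReal.ofReal_coe_nnreal, ← ENNReal.ofReal_mul (NNReal.coe_nonneg c)]
    refine ENNReal.ofReal_le_ofReal ((h.abs_code_sub_le he hL1 hL hx hy).trans_eq ?_)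
    rw [Real.mul_rpow (by positivity) (abs_nonneg _)]
    rfl
  have h1 := hH.dimH_image_le hr0
  have h2 : dimH (Ico (0:ℝ) 1) = 1 := by
    rw [Real.dimH_of_nonempty_interior (by rw [interior_Ico]; exact ⟨1 / 2, by norm_num⟩)]
    simp
  rw [pos_iff_ne_zero]
  intro h0
  have h3 := (dimH_mono (h.Ico_subset_image_code he)).trans h1
  rw [h2, h0, ENNReal.zero_div] at h3
  exact absurd h3 (by simp)

lemma dimH_Lambda_pos_of_zero (h : TwoBranched 0 f p) : 0 < dimH (Lambda f) := by
  have hmaps : MapsTo f (Icc (-1) 1) (Icc (-1) 1) := by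
    have key (b : Bool) (t : ℝ) (ht : t ∈ Icc (0:ℝ) 1) :
        f (letterSign b * t) ∈ Icc (-1:ℝ) 1 := by
      rw [h.map_eq b t ht]
      have h1 := (h.mono b).monotoneOn (by simp) ht ht.1
      have h2 := (h.mono b).monotoneOn ht (by simp) ht.2
      rw [h.map_zero] at h1
      rw [h.map_one] at h2
      constructor <;> linarith
    intro x hx
    rcases le_total 0 x with h0 | h0
    · simpa [letterSign] using key true x ⟨h0, hx.2⟩
    · simpa [letterSign] using key false (-x) ⟨by linarith, by linarith [hx.1]⟩
  have hsub : Icc (-1:ℝ) 1 ⊆ Lambda f := fun x hx n => hmaps.iterate n hx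
  refine lt_of_lt_of_le ?_ (dimH_mono hsub)
  rw [Real.dimH_of_nonempty_interior (by rw [interior_Icc]; exact ⟨0, by norm_num⟩)]
  simp

end TwoBranched

lemma ControlledSystem.dimH_Lambda_pos {γ m M K α C θ e : ℝ} {f : ℝ → ℝ} {p p' : Bool → ℝ → ℝ}
    (h : ControlledSystem γ m M K α C θ e f p p') : 0 < dimH (Lambda f) := by
  rcases h.e_nonneg.eq_or_lt with rfl | he
  · exact h.toTwoBranched.dimH_Lambda_pos_of_zero
  have hM := (h.prof false).M_pos
  refine h.dimH_Lambda_pos_of_pos he (L := M + 1) (by linarith) fun b s t hs hst ht => ?_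
  have h1 := (h.prof b).sub_le hs hst ht
  have h2 : t ^ (γ - 1) ≤ 1 :=
    Real.rpow_le_one (hs.trans hst) ht (by linarith [(h.prof b).one_lt])
  have h3 : M * t ^ (γ - 1) * (t - s) ≤ M * 1 * (t - s) := by gcongr
  linarith

lemma exists_abs_bounds {s : Set (ℝ × ℝ)} (hs : IsCompact s) (hne : s.Nonempty) {g : ℝ × ℝ → ℝ}
    (hg : ContinuousOn g s) (h0 : ∀ q ∈ s, g q ≠ 0) :
    ∃ m > 0, ∃ M, ∀ q ∈ s, m ≤ |g q| ∧ |g q| ≤ M := by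
  obtain ⟨a, ha, hmin⟩ := hs.exists_isMinOn hne hg.abs
  obtain ⟨b, -, hmax⟩ := hs.exists_isMaxOn hne hg.abs
  exact ⟨|g a|, abs_pos.2 (h0 a ha), |g b|, fun q hq => ⟨hmin hq, hmax hq⟩⟩

namespace GoodFamily

variable (F : GoodFamily)

/-- The profile of `F.f ε` on the half-interval selected by `b`. -/
def profile (ε : ℝ) (b : Bool) (t : ℝ) : ℝ := 1 + ε - F.f ε (letterSign b * t)

/-- The derivative of `F.profile`. -/
def profileDeriv (ε : ℝ) (b : Bool) (t : ℝ) : ℝ := -(letterSign b * F.f' ε (letterSign b * t))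

lemma f'_nonneg {ε : ℝ} (hε : ε ∈ Icc 0 F.eps0) {x : ℝ} (hx : x ∈ Icc (-1:ℝ) 0) :
    0 ≤ F.f' ε x := by
  have h1 := (F.deriv_f ε hε x ⟨hx.1, by linarith [hx.2]⟩).mono
    (Icc_subset_Icc le_rfl zero_le_one : Icc (-1:ℝ) 0 ⊆ Icc (-1) 1)
  rw [← h1.derivWithin (uniqueDiffOn_Icc (by norm_num) x hx)]
  exact (F.mono ε hε).monotoneOn.derivWithin_nonneg

lemma f'_nonpos {ε : ℝ} (hε : ε ∈ Icc 0 F.eps0) {x : ℝ} (hx : x ∈ Icc (0:ℝ) 1) :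
    F.f' ε x ≤ 0 := by
  have h1 := (F.deriv_f ε hε x ⟨by linarith [hx.1], hx.2⟩).mono
    (Icc_subset_Icc (by norm_num) le_rfl : Icc (0:ℝ) 1 ⊆ Icc (-1) 1)
  rw [← h1.derivWithin (uniqueDiffOn_Icc (by norm_num) x hx)]
  exact (F.anti ε hε).antitoneOn.derivWithin_nonpos

lemma letterSign_mul_mem (b : Bool) {t : ℝ} (ht : t ∈ Icc (0:ℝ) 1) :
    letterSign b * t ∈ Icc (-1:ℝ) 1 := by
  rw [mem_Icc, ← abs_le, abs_mul, abs_letterSign, one_mul, abs_of_nonneg ht.1]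
  exact ht.2

lemma abs_letterSign_mul_sub (b : Bool) (s t : ℝ) :
    |letterSign b * s - letterSign b * t| = |s - t| := by
  rw [← mul_sub, abs_mul, abs_letterSign, one_mul]

lemma profileDeriv_eq {ε : ℝ} (hε : ε ∈ Icc 0 F.eps0) (b : Bool) {t : ℝ}
    (ht : t ∈ Icc (0:ℝ) 1) : F.profileDeriv ε b t = |F.f' ε (letterSign b * t)| := by
  cases b
  · have := F.f'_nonneg hε (x := -t) ⟨by linarith [ht.2], by linarith [ht.1]⟩
    simp [profileDeriv, letterSign, abs_of_nonneg this]
  · have := F.f'_nonpos hε ht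
    simp [profileDeriv, letterSign, abs_of_nonpos this]

lemma exists_bounds : ∃ m > 0, ∃ M, ∀ ε ∈ Icc 0 F.eps0, ∀ b, ∀ t ∈ Ioc (0:ℝ) 1,
    m * t ^ (F.gamma - 1) ≤ F.profileDeriv ε b t ∧
      F.profileDeriv ε b t ≤ M * t ^ (F.gamma - 1) := by
  obtain ⟨m₁, hm₁, M₁, h₁⟩ := exists_abs_bounds (isCompact_Icc.prod isCompact_Icc)
    ⟨(0, 0), by simp [F.eps0_pos.le]⟩ F.Rneg_cont (fun q hq => F.Rneg_ne q.1 hq.1 q.2 hq.2)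
  obtain ⟨m₂, hm₂, M₂, h₂⟩ := exists_abs_bounds (isCompact_Icc.prod isCompact_Icc)
    ⟨(0, 0), by simp [F.eps0_pos.le]⟩ F.Rpos_cont (fun q hq => F.Rpos_ne q.1 hq.1 q.2 hq.2)
  refine ⟨min m₁ m₂, lt_min hm₁ hm₂, max M₁ M₂, fun ε hε b t ht => ?_⟩
  have ht0 : 0 < t ^ (F.gamma - 1) := Real.rpow_pos_of_pos ht.1 _
  rw [F.profileDeriv_eq hε b (Ioc_subset_Icc_self ht)]
  suffices hs : min m₁ m₂ ≤ |F.f' ε (letterSign b * t)| / t ^ (F.gamma - 1) ∧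
      |F.f' ε (letterSign b * t)| / t ^ (F.gamma - 1) ≤ max M₁ M₂ by
    rwa [le_div_iff₀ ht0, div_le_iff₀ ht0] at hs
  cases b
  · have hx : -t ∈ Ico (-1:ℝ) 0 := ⟨by linarith [ht.2], by linarith [ht.1]⟩
    have h3 := h₁ (ε, -t) ⟨hε, Ico_subset_Icc_self hx⟩
    simp only [F.Rneg_eq ε hε _ hx, abs_div, abs_neg, abs_of_pos ht.1, abs_of_pos ht0] at h3
    simp only [letterSign, neg_one_mul]
    exact ⟨(min_le_left _ _).trans h3.1, h3.2.trans (le_max_left _ _)⟩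
  · have h3 := h₂ (ε, t) ⟨hε, Ioc_subset_Icc_self ht⟩
    simp only [F.Rpos_eq ε hε _ ht, abs_div, abs_of_pos ht.1, abs_of_pos ht0] at h3
    simp only [letterSign, one_mul]
    exact ⟨(min_le_right _ _).trans h3.1, h3.2.trans (le_max_right _ _)⟩

lemma mul_rpow_le {K L a b d : ℝ} (hK : 0 ≤ K) (hKL : K ≤ L) (hb : 0 < b) (hba : b ≤ a)
    (hd0 : 0 ≤ d) (hd1 : d ≤ 1) : K * d ^ a ≤ L * d ^ b :=
  mul_le_mul hKL (Real.rpow_le_rpow_of_exponent_ge' hd0 hd1 hb.le hba) (Real.rpow_nonneg hd0 _)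
    (hK.trans hKL)

lemma abs_sub_le_one {s t : ℝ} (hs : s ∈ Ioc (0:ℝ) 1) (ht : t ∈ Ioc (0:ℝ) 1) : |s - t| ≤ 1 :=
  abs_le.2 ⟨by linarith [hs.1, ht.2], by linarith [hs.2, ht.1]⟩

lemma profile_continuousOn {ε : ℝ} (hε : ε ∈ Icc 0 F.eps0) (b : Bool) :
    ContinuousOn (F.profile ε b) (Icc 0 1) := by
  have h1 : ContinuousOn (F.f ε) (Icc (-1) 1) :=
    fun x hx => (F.deriv_f ε hε x hx).continuousWithinAt
  exact continuousOn_const.sub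
    (h1.comp (continuous_const.mul continuous_id).continuousOn fun t ht => letterSign_mul_mem b ht)

lemma profile_hasDerivAt {ε : ℝ} (hε : ε ∈ Icc 0 F.eps0) (b : Bool) {t : ℝ}
    (ht : t ∈ Ioo (0:ℝ) 1) : HasDerivAt (F.profile ε b) (F.profileDeriv ε b t) t := by
  have hlt : |letterSign b * t| < 1 := by
    rw [abs_mul, abs_letterSign, one_mul, abs_of_pos ht.1]
    exact ht.2
  have h1 := (F.deriv_f ε hε _ (letterSign_mul_mem b (Ioo_subset_Icc_self ht))).hasDerivAt
    (Icc_mem_nhds (abs_lt.1 hlt).1 (abs_lt.1 hlt).2)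
  have h2 := (h1.comp t ((hasDerivAt_id t).const_mul (letterSign b))).const_sub (1 + ε)
  exact h2.congr_deriv (by simp only [profileDeriv]; ring)

lemma powerProfile {ε m M : ℝ} (hε : ε ∈ Icc 0 F.eps0) (hm : 0 < m)
    (hmM : ∀ b, ∀ t ∈ Ioc (0:ℝ) 1, m * t ^ (F.gamma - 1) ≤ F.profileDeriv ε b t ∧
      F.profileDeriv ε b t ≤ M * t ^ (F.gamma - 1)) (b : Bool) :
    PowerProfile F.gamma m M (max F.K' F.K'') (min F.alpha' F.alpha'') (F.profile ε b)
      (F.profileDeriv ε b) where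
  one_lt := F.one_lt_gamma
  m_pos := hm
  K_nonneg := F.K'_pos.le.trans (le_max_left _ _)
  α_pos := lt_min F.alpha'_mem.1 F.alpha''_mem.1
  α_le := (min_le_left _ _).trans F.alpha'_mem.2
  cont := F.profile_continuousOn hε b
  hasDeriv t ht := F.profile_hasDerivAt hε b ht
  lower t ht := (hmM b t ht).1
  upper t ht := (hmM b t ht).2
  holder_ratio s hs t ht := by
    refine le_trans ?_ (mul_rpow_le F.K''_pos.le (le_max_right _ _)
      (lt_min F.alpha'_mem.1 F.alpha''_mem.1) (min_le_right _ _) (abs_nonneg _)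
      (abs_sub_le_one hs ht))
    cases b
    · have := F.holder''_neg ε hε (-s) ⟨by linarith [hs.2], by linarith [hs.1]⟩ (-t)
        ⟨by linarith [ht.2], by linarith [ht.1]⟩
      rw [abs_neg, abs_neg, abs_of_pos hs.1, abs_of_pos ht.1, neg_sub_neg, abs_sub_comm t s] at this
      simpa [profileDeriv, letterSign] using this
    · have := F.holder''_pos ε hε s hs t ht
      rw [abs_of_pos hs.1, abs_of_pos ht.1, abs_sub_comm] at this
      simpa [profileDeriv, letterSign, neg_div, neg_add_eq_sub] using this
  holder s hs t ht := by
    refine le_trans ?_ (mul_rpow_le F.K'_pos.le (le_max_left _ _)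
      (lt_min F.alpha'_mem.1 F.alpha''_mem.1) (min_le_left _ _) (abs_nonneg _)
      (abs_sub_le_one hs ht))
    have := F.holder' ε hε _ (letterSign_mul_mem b (Ioc_subset_Icc_self hs)) _
      (letterSign_mul_mem b (Ioc_subset_Icc_self ht))
    rw [abs_letterSign_mul_sub] at this
    rwa [profileDeriv, profileDeriv, neg_sub_neg, abs_letterSign_mul_sub, abs_sub_comm]

lemma twoBranched {ε : ℝ} (hε : ε ∈ Icc 0 F.eps0) : TwoBranched ε (F.f ε) (F.profile ε) where
  e_nonneg := hε.1
  map_eq b t _ := by simp [profile]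
  cont := F.profile_continuousOn hε
  mono b s hs t ht hst := by
    cases b
    · have := F.mono ε hε (a := -t) ⟨by linarith [ht.2], by linarith [ht.1]⟩ (b := -s)
        ⟨by linarith [hs.2], by linarith [hs.1]⟩ (neg_lt_neg hst)
      simpa [profile, letterSign] using this
    · simpa [profile, letterSign] using F.anti ε hε hs ht hst
  map_zero b := by simp [profile, F.map_zero ε hε]
  map_one b := by
    cases b <;> simp [profile, letterSign, F.map_one ε hε, F.map_neg_one ε hε] <;> ring

lemma length_le {ε : ℝ} (hε : ε ∈ Icc 0 F.eps0) (w : List Bool) :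
    hi (F.f ε) w - lo (F.f ε) w ≤ (F.C0 + 2) / F.lam * F.lam ^ w.length := by
  have h := F.twoBranched hε
  have hl := F.lam_mem.1
  rw [div_mul_eq_mul_div, le_div_iff₀ hl]
  rcases le_or_gt w.length 1 with hw | hw
  · have h1 : F.lam ≤ F.lam ^ w.length := by
      simpa using pow_le_pow_of_le_one hl.le F.lam_mem.2.le hw
    have h2 : hi (F.f ε) w - lo (F.f ε) w ≤ F.C0 + 2 := by
      linarith [(h.lo_mem w).1, (h.hi_mem w).2, F.C0_pos]
    exact mul_le_mul h2 h1 hl.le (by linarith [F.C0_pos])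
  · obtain ⟨n, hn⟩ : ∃ n, w.length = n + 1 := ⟨w.length - 1, by omega⟩
    have h1 := F.decay ε hε n (by omega) w hn
    rw [h.len_Iw] at h1
    rw [hn, pow_succ, ← mul_assoc]
    refine mul_le_mul_of_nonneg_right (h1.trans ?_) hl.le
    exact mul_le_mul_of_nonneg_right (by linarith) (pow_nonneg hl.le _)

lemma controlledSystem {ε m M : ℝ} (hε : ε ∈ Icc 0 F.eps0) (hm : 0 < m)
    (hmM : ∀ b, ∀ t ∈ Ioc (0:ℝ) 1, m * t ^ (F.gamma - 1) ≤ F.profileDeriv ε b t ∧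
      F.profileDeriv ε b t ≤ M * t ^ (F.gamma - 1)) :
    ControlledSystem F.gamma m M (max F.K' F.K'') (min F.alpha' F.alpha'')
      ((F.C0 + 2) / F.lam) (F.lam ^ min F.alpha' F.alpha'') ε (F.f ε) (F.profile ε)
      (F.profileDeriv ε) := by
  have hα0 : 0 < min F.alpha' F.alpha'' := lt_min F.alpha'_mem.1 F.alpha''_mem.1
  have hα1 : min F.alpha' F.alpha'' ≤ 1 := (min_le_left _ _).trans F.alpha'_mem.2
  have hl := F.lam_mem.1
  have hC1 : 1 ≤ (F.C0 + 2) / F.lam := by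
    rw [one_le_div hl]
    linarith [F.lam_mem.2, F.C0_pos]
  have hC0 : 0 < (F.C0 + 2) / F.lam := one_pos.trans_le hC1
  refine
    { F.twoBranched hε with
      prof := F.powerProfile hε hm hmM
      C_pos := hC0
      θ_pos := Real.rpow_pos_of_pos hl _
      θ_lt := Real.rpow_lt_one hl.le F.lam_mem.2 hα0
      decay := fun w => (F.length_le hε w).trans ?_
      decay_rpow := fun w => ?_ }
  · refine mul_le_mul_of_nonneg_left (pow_le_pow_left₀ hl.le ?_ _) hC0.le
    simpa using Real.rpow_le_rpow_of_exponent_ge hl F.lam_mem.2.le hα1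
  · refine (Real.rpow_le_rpow (sub_pos.2 ((F.twoBranched hε).lo_lt_hi w)).le (F.length_le hε w)
      hα0.le).trans ?_
    rw [Real.mul_rpow hC0.le (pow_nonneg hl.le _), Real.rpow_pow_comm hl.le]
    refine mul_le_mul_of_nonneg_right ?_ (by positivity)
    simpa using Real.rpow_le_rpow_of_exponent_le hC1 hα1

end GoodFamily

/-- Corollary 2: for a good family with power-law exponent `γ`, there is a
constant `C > 0` independent of `ε` such that the Hausdorff dimension of the maximal
invariant set `Λ_ε` satisfies `0 < HD(ε) ≤ 1 - C ε^{1/γ}` for all `0 ≤ ε ≤ ε₀`. -/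
theorem hausdorff_dimension_upper_bound (F : GoodFamily) :
    ∃ C > (0:ℝ), ∀ ε ∈ Icc 0 F.eps0,
      0 < dimH (Lambda (F.f ε)) ∧
      dimH (Lambda (F.f ε)) ≤ ENNReal.ofReal (1 - C * ε ^ (1 / F.gamma)) := by
  obtain ⟨m, hm, M, hmM⟩ := F.exists_bounds
  have hsys := fun ε hε => F.controlledSystem hε hm (hmM ε hε)
  have hM : 0 < M := ((hsys 0 ⟨le_rfl, F.eps0_pos.le⟩).prof false).M_pos
  refine ⟨_, half_pos (ControlledSystem.gapConst_pos (γ := F.gamma) (m := m)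
    (K := max F.K' F.K'') (C := (F.C0 + 2) / F.lam)
    (θ := F.lam ^ min F.alpha' F.alpha'') hM), fun ε hε =>
    ⟨(hsys ε hε).dimH_Lambda_pos, (hsys ε hε).dimH_Lambda_le.trans_eq ?_⟩⟩
  rw [ControlledSystem.dimBound, mul_div_right_comm]
end

section
/- Let {f_ε}_{0≤ε≤ε₀} be a good family with power law exponent γ > 1 and let s_ε denote the scaling function of f_ε. Then there is a constant C > 0, not depending on ε, such that 1 − C^{-1}ε^{1/γ} ≤ s_ε((a*0.)) + s_ε((a*1.)) ≤ 1 − Cε^{1/γ} for all a* in the dual Cantor set C* and all 0 < ε ≤ ε₀, where (a*0.) and (a*1.) denote the strings obtained from a* by appending a final coordinate 0, respectively 1. -/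
open Set MeasureTheory Filter Topology

/-- Appending a final (rightmost) coordinate to a dual point: `(a*i.)` has last coordinate
`i` and `(a*i.)ₙ₊₁ = a*ₙ`. -/
def push (a : ℕ → Bool) (i : Bool) : ℕ → Bool
  | 0 => i
  | n + 1 => a n

/-- A unimodal map folded onto one side of its turning point `0`: `u` decreases from `1 + ε` to
`-1` on `[0, 1]`, its derivative is comparable to `-t ^ (γ - 1)`, and both the derivative and its
quotient by the power law are Hölder. -/
structure FoldedBranch (γ r R K α ε : ℝ) (u u' : ℝ → ℝ) : Prop where
  one_lt : 1 < γ
  r_pos : 0 < r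
  K_nonneg : 0 ≤ K
  α_mem : α ∈ Ioc (0:ℝ) 1
  ε_nonneg : 0 ≤ ε
  cont : ContinuousOn u (Icc 0 1)
  hasDeriv : ∀ t ∈ Ioo (0:ℝ) 1, HasDerivAt u (u' t) t
  map_zero : u 0 = 1 + ε
  map_one : u 1 = -1
  lower : ∀ t ∈ Ioo (0:ℝ) 1, r * t ^ (γ - 1) ≤ -u' t
  upper : ∀ t ∈ Ioo (0:ℝ) 1, -u' t ≤ R * t ^ (γ - 1)
  holder : ∀ t ∈ Ioo (0:ℝ) 1, ∀ s ∈ Ioo (0:ℝ) 1, |u' t - u' s| ≤ K * |t - s| ^ α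
  holder_ratio : ∀ t ∈ Ioo (0:ℝ) 1, ∀ s ∈ Ioo (0:ℝ) 1,
    |u' t / t ^ (γ - 1) - u' s / s ^ (γ - 1)| ≤ K * |t - s| ^ α

theorem abs_log_sub_log_le {m a b : ℝ} (hm : 0 < m) (ha : m ≤ a) (hb : m ≤ b) :
    |Real.log a - Real.log b| ≤ |a - b| / m := by
  have key : ∀ {a b : ℝ}, m ≤ a → m ≤ b → Real.log a - Real.log b ≤ |a - b| / m := by
    intro a b ha hb
    have ha0 := hm.trans_le ha
    have hb0 := hm.trans_le hb
    rw [← Real.log_div ha0.ne' hb0.ne']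
    calc Real.log (a / b) ≤ a / b - 1 := Real.log_le_sub_one_of_pos (by positivity)
      _ = (a - b) / b := by field_simp
      _ ≤ |a - b| / b := by gcongr; exact le_abs_self _
      _ ≤ |a - b| / m := by gcongr
  rw [abs_le]
  have h1 := key ha hb
  have h2 := key hb ha
  rw [abs_sub_comm] at h2
  constructor <;> linarith

theorem abs_log_add_sub_log_add_le {e a b : ℝ} (he : 0 ≤ e) (ha : 0 < a) (hb : 0 < b) :
    |Real.log (e + a) - Real.log (e + b)| ≤ |Real.log a - Real.log b| := by
  wlog hab : b ≤ a generalizing a b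
  · rw [abs_sub_comm, abs_sub_comm (Real.log a)]
    exact this hb ha (le_of_not_ge hab)
  rw [abs_of_nonneg (sub_nonneg.2 (Real.log_le_log (by positivity) (by linarith))),
    abs_of_nonneg (sub_nonneg.2 (Real.log_le_log hb hab)),
    ← Real.log_div (by positivity) (by positivity), ← Real.log_div ha.ne' hb.ne']
  apply Real.log_le_log (by positivity)
  rw [div_le_div_iff₀ (by positivity) hb]
  nlinarith

namespace FoldedBranch

variable {γ r R K α ε : ℝ} {u u' : ℝ → ℝ}

theorem exists_sub_eq (h : FoldedBranch γ r R K α ε u u') {a b : ℝ} (ha : 0 ≤ a) (hab : a < b)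
    (hb : b ≤ 1) : ∃ c ∈ Ioo (0:ℝ) 1, u a - u b = (b ^ γ - a ^ γ) * (-u' c / (γ * c ^ (γ - 1))) := by
  have hγ := h.one_lt
  obtain ⟨c, hc, hc'⟩ := exists_ratio_hasDerivAt_eq_ratio_slope u u' hab
    (h.cont.mono (Icc_subset_Icc ha hb))
    (fun x hx => h.hasDeriv x ⟨ha.trans_lt hx.1, hx.2.trans_le hb⟩)
    (fun x => x ^ γ) (fun x => γ * x ^ (γ - 1))
    (Real.continuous_rpow_const (by linarith)).continuousOn
    (fun x hx => Real.hasDerivAt_rpow_const (Or.inr hγ.le))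
  have hc0 : 0 < c := ha.trans_lt hc.1
  have : 0 < c ^ (γ - 1) := Real.rpow_pos_of_pos hc0 _
  refine ⟨c, ⟨hc0, hc.2.trans_le hb⟩, ?_⟩
  field_simp
  linarith

theorem sub_ge (h : FoldedBranch γ r R K α ε u u') {a b : ℝ} (ha : 0 ≤ a) (hab : a < b)
    (hb : b ≤ 1) : r / γ * (b ^ γ - a ^ γ) ≤ u a - u b := by
  have hγ := h.one_lt
  obtain ⟨c, hc, hc'⟩ := h.exists_sub_eq ha hab hb
  have : 0 < c ^ (γ - 1) := Real.rpow_pos_of_pos hc.1 _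
  have h2 := Real.rpow_lt_rpow ha hab (by linarith : 0 < γ)
  rw [hc', mul_comm]
  apply mul_le_mul_of_nonneg_left _ (by linarith)
  rw [div_le_div_iff₀ (by linarith) (by positivity)]
  nlinarith [h.lower c hc]

theorem sub_le (h : FoldedBranch γ r R K α ε u u') {a b : ℝ} (ha : 0 ≤ a) (hab : a < b)
    (hb : b ≤ 1) : u a - u b ≤ R / γ * (b ^ γ - a ^ γ) := by
  have hγ := h.one_lt
  obtain ⟨c, hc, hc'⟩ := h.exists_sub_eq ha hab hb
  have : 0 < c ^ (γ - 1) := Real.rpow_pos_of_pos hc.1 _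
  have h2 := Real.rpow_lt_rpow ha hab (by linarith : 0 < γ)
  rw [hc', mul_comm (R / γ)]
  apply mul_le_mul_of_nonneg_left _ (by linarith)
  rw [div_le_div_iff₀ (by positivity) (by linarith)]
  nlinarith [h.upper c hc]

theorem top_sub_ge (h : FoldedBranch γ r R K α ε u u') {t : ℝ} (ht : t ∈ Ioo (0:ℝ) 1) :
    r / γ * t ^ γ ≤ 1 + ε - u t := by
  have := h.sub_ge le_rfl ht.1 ht.2.le
  rwa [h.map_zero, Real.zero_rpow (by linarith [h.one_lt]), sub_zero] at this

theorem top_sub_le (h : FoldedBranch γ r R K α ε u u') {t : ℝ} (ht : t ∈ Ioo (0:ℝ) 1) :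
    1 + ε - u t ≤ R / γ * t ^ γ := by
  have := h.sub_le le_rfl ht.1 ht.2.le
  rwa [h.map_zero, Real.zero_rpow (by linarith [h.one_lt]), sub_zero] at this

theorem add_one_ge (h : FoldedBranch γ r R K α ε u u') {t : ℝ} (ht : t ∈ Ioo (0:ℝ) 1) :
    r / γ * (1 - t) ≤ u t + 1 := by
  have hγ := h.one_lt
  have := h.sub_ge ht.1.le ht.2 le_rfl
  rw [h.map_one, Real.one_rpow] at this
  have h2 : t ^ γ ≤ t := by
    simpa using Real.rpow_le_rpow_of_exponent_ge ht.1 ht.2.le hγ.le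
  have h3 : 0 < r / γ := div_pos h.r_pos (by linarith)
  nlinarith

theorem R_pos (h : FoldedBranch γ r R K α ε u u') : 0 < R := by
  have h1 := h.lower (1/2) (by norm_num)
  have h2 := h.upper (1/2) (by norm_num)
  have h3 : (0:ℝ) < (1/2:ℝ) ^ (γ - 1) := by positivity
  by_contra hR
  nlinarith [h.r_pos, mul_pos h.r_pos h3]

theorem add_one_le (h : FoldedBranch γ r R K α ε u u') {t : ℝ} (ht : t ∈ Ioo (0:ℝ) 1) :
    u t + 1 ≤ R * (1 - t) := by
  have hγ := h.one_lt
  have := h.sub_le ht.1.le ht.2 le_rfl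
  rw [h.map_one, Real.one_rpow] at this
  have h2 : 1 + γ * (t - 1) ≤ t ^ γ := by
    simpa using one_add_mul_self_le_rpow_one_add (by linarith [ht.1] : -1 ≤ t - 1) hγ.le
  have h3 : 0 < R / γ := div_pos h.R_pos (by linarith)
  have h4 : R / γ * (1 - t ^ γ) ≤ R / γ * (γ * (1 - t)) := by gcongr; linarith
  have h5 : R / γ * (γ * (1 - t)) = R * (1 - t) := by field_simp
  linarith

theorem top_quotient_holder (h : FoldedBranch γ r R K α ε u u') {t s : ℝ}
    (ht : t ∈ Ioo (0:ℝ) 1) (hs : s ∈ Ioo (0:ℝ) 1) :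
    |(1 + ε - u t) / t ^ γ - (1 + ε - u s) / s ^ γ| ≤ K * |t - s| ^ α := by
  have hγ := h.one_lt
  have hd : ∀ {t : ℝ}, t ∈ Ioo (0:ℝ) 1 → ∀ v ∈ Ioo (0:ℝ) 1,
      HasDerivAt (fun v => (1 + ε - u (t * v)) / t ^ γ)
        (-(u' (t * v) / (t * v) ^ (γ - 1)) * v ^ (γ - 1)) v := by
    intro t ht v hv
    have hm : t * v ∈ Ioo (0:ℝ) 1 := ⟨mul_pos ht.1 hv.1, by nlinarith [ht.1, ht.2, hv.1, hv.2]⟩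
    have h1 : HasDerivAt (fun v => t * v) t v := by simpa using (hasDerivAt_id v).const_mul t
    have h2 := (((h.hasDeriv _ hm).comp v h1).const_sub (1 + ε)).div_const (t ^ γ)
    refine h2.congr_deriv ?_
    rw [Real.mul_rpow ht.1.le hv.1.le]
    have e : t ^ γ = t ^ (γ - 1) * t := by
      rw [← Real.rpow_add_one ht.1.ne']; congr 1; ring
    rw [e]
    have := Real.rpow_pos_of_pos ht.1 (γ - 1)
    have := Real.rpow_pos_of_pos hv.1 (γ - 1)
    have := ht.1
    field_simp
  have hcont : ∀ {t : ℝ}, t ∈ Ioo (0:ℝ) 1 →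
      ContinuousOn (fun v => (1 + ε - u (t * v)) / t ^ γ) (Icc 0 1) := by
    intro t ht
    refine (continuousOn_const.sub (h.cont.comp (by fun_prop) ?_)).div_const _
    intro v hv
    exact ⟨mul_nonneg ht.1.le hv.1, by nlinarith [ht.1, ht.2, hv.1, hv.2]⟩
  obtain ⟨v, hv, hv'⟩ := exists_hasDerivAt_eq_slope
    (fun v => (1 + ε - u (t * v)) / t ^ γ - (1 + ε - u (s * v)) / s ^ γ) _
    zero_lt_one ((hcont ht).sub (hcont hs)) (fun v hv => (hd ht v hv).sub (hd hs v hv))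
  simp only [mul_one, mul_zero, h.map_zero, sub_self, zero_div, sub_zero, div_one] at hv'
  rw [← hv']
  have hmt : t * v ∈ Ioo (0:ℝ) 1 := ⟨mul_pos ht.1 hv.1, by nlinarith [ht.1, ht.2, hv.1, hv.2]⟩
  have hms : s * v ∈ Ioo (0:ℝ) 1 := ⟨mul_pos hs.1 hv.1, by nlinarith [hs.1, hs.2, hv.1, hv.2]⟩
  have e : -(u' (t * v) / (t * v) ^ (γ - 1)) * v ^ (γ - 1) -
      -(u' (s * v) / (s * v) ^ (γ - 1)) * v ^ (γ - 1) =
      -((u' (t * v) / (t * v) ^ (γ - 1) - u' (s * v) / (s * v) ^ (γ - 1)) * v ^ (γ - 1)) := by ring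
  rw [e, abs_neg, abs_mul]
  have hv1 : |v ^ (γ - 1)| ≤ 1 := by
    rw [abs_of_nonneg (Real.rpow_nonneg hv.1.le _)]
    exact Real.rpow_le_one hv.1.le hv.2.le (by linarith)
  refine (mul_le_of_le_one_right (abs_nonneg _) hv1).trans ((h.holder_ratio _ hmt _ hms).trans ?_)
  refine mul_le_mul_of_nonneg_left (Real.rpow_le_rpow (abs_nonneg _) ?_ h.α_mem.1.le) h.K_nonneg
  rw [← sub_mul, abs_mul]
  exact mul_le_of_le_one_right (abs_nonneg _) (by rw [abs_of_pos hv.1]; exact hv.2.le)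

theorem bot_quotient_holder (h : FoldedBranch γ r R K α ε u u') {t s : ℝ}
    (ht : t ∈ Ioo (0:ℝ) 1) (hs : s ∈ Ioo (0:ℝ) 1) :
    |(u t + 1) / (1 - t) - (u s + 1) / (1 - s)| ≤ K * |t - s| ^ α := by
  have hmem : ∀ {t : ℝ}, t ∈ Ioo (0:ℝ) 1 → ∀ v ∈ Ioo (0:ℝ) 1, 1 - (1 - t) * v ∈ Ioo (0:ℝ) 1 :=
    fun ht v hv => ⟨by nlinarith [ht.1, ht.2, hv.1, hv.2], by nlinarith [ht.1, ht.2, hv.1, hv.2]⟩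
  have hd : ∀ {t : ℝ}, t ∈ Ioo (0:ℝ) 1 → ∀ v ∈ Ioo (0:ℝ) 1,
      HasDerivAt (fun v => (u (1 - (1 - t) * v) + 1) / (1 - t)) (-u' (1 - (1 - t) * v)) v := by
    intro t ht v hv
    have h1 : HasDerivAt (fun v => 1 - (1 - t) * v) (-(1 - t)) v := by
      simpa using ((hasDerivAt_id v).const_mul (1 - t)).const_sub 1
    have h2 := (((h.hasDeriv _ (hmem ht v hv)).comp v h1).add_const 1).div_const (1 - t)
    refine h2.congr_deriv ?_
    have : 1 - t ≠ 0 := by linarith [ht.2]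
    field_simp
  have hcont : ∀ {t : ℝ}, t ∈ Ioo (0:ℝ) 1 →
      ContinuousOn (fun v => (u (1 - (1 - t) * v) + 1) / (1 - t)) (Icc 0 1) := by
    intro t ht
    refine ((h.cont.comp (by fun_prop) ?_).add continuousOn_const).div_const _
    intro v hv
    exact ⟨by nlinarith [ht.1, ht.2, hv.1, hv.2], by nlinarith [ht.1, ht.2, hv.1, hv.2]⟩
  obtain ⟨v, hv, hv'⟩ := exists_hasDerivAt_eq_slope
    (fun v => (u (1 - (1 - t) * v) + 1) / (1 - t) - (u (1 - (1 - s) * v) + 1) / (1 - s)) _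
    zero_lt_one ((hcont ht).sub (hcont hs)) (fun v hv => (hd ht v hv).sub (hd hs v hv))
  simp only [mul_one, mul_zero, h.map_one, sub_zero, div_one, sub_sub_cancel, neg_add_cancel,
    zero_div] at hv'
  rw [← hv', neg_sub_neg, abs_sub_comm]
  refine (h.holder _ (hmem ht v hv) _ (hmem hs v hv)).trans ?_
  refine mul_le_mul_of_nonneg_left (Real.rpow_le_rpow (abs_nonneg _) ?_ h.α_mem.1.le) h.K_nonneg
  rw [show 1 - (1 - t) * v - (1 - (1 - s) * v) = (t - s) * v by ring, abs_mul]
  exact mul_le_of_le_one_right (abs_nonneg _) (by rw [abs_of_pos hv.1]; exact hv.2.le)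

theorem log_distortion (h : FoldedBranch γ r R K α ε u u') {t s : ℝ}
    (ht : t ∈ Ioo (0:ℝ) 1) (hs : s ∈ Ioo (0:ℝ) 1) (hut : u t < 1) (hus : u s < 1) :
    |Real.log (u' t) - Real.log (u' s)| + (1 - 1 / γ) *
        (|Real.log (1 - t) - Real.log (1 - s)| + |Real.log (1 + t) - Real.log (1 + s)|) ≤
      (1 - 1 / γ) * (|Real.log (1 - u t) - Real.log (1 - u s)| +
        |Real.log (1 + u t) - Real.log (1 + u s)|) + (3 * K * γ / r + 1) * |t - s| ^ α := by
  have hγ := h.one_lt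
  have hr := h.r_pos
  have hK := h.K_nonneg
  have hrg : 0 < r / γ := div_pos hr (by linarith)
  set H := |t - s| ^ α with hH
  have hH0 : 0 ≤ H := by positivity
  have hκ0 : 0 ≤ 1 - 1 / γ := by
    rw [sub_nonneg, div_le_one (by linarith)]; exact hγ.le
  have hκ1 : 1 - 1 / γ ≤ 1 := by
    have : 0 < 1 / γ := by positivity
    linarith
  have e1 : ∀ {t}, t ∈ Ioo (0:ℝ) 1 → u t < 1 → Real.log (u' t) =
      Real.log (-(u' t / t ^ (γ - 1))) +
        (1 - 1 / γ) * (Real.log (ε + (1 - u t)) - Real.log ((1 + ε - u t) / t ^ γ)) := by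
    intro t ht hut
    have hp := Real.rpow_pos_of_pos ht.1 (γ - 1)
    have hp2 := Real.rpow_pos_of_pos ht.1 γ
    have hneg : 0 < -u' t := lt_of_lt_of_le (mul_pos hr hp) (h.lower t ht)
    rw [← Real.log_neg_eq_log, ← neg_div, Real.log_div hneg.ne' hp.ne',
      Real.log_div (by linarith [h.ε_nonneg]) hp2.ne', Real.log_rpow ht.1, Real.log_rpow ht.1,
      show ε + (1 - u t) = 1 + ε - u t by ring]
    field_simp
    ring
  have e2 : ∀ {t}, t ∈ Ioo (0:ℝ) 1 → Real.log (1 - t) =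
      Real.log (1 + u t) - Real.log ((u t + 1) / (1 - t)) := by
    intro t ht
    have h1 := h.add_one_ge ht
    have h2 : 0 < 1 - t := by linarith [ht.2]
    have h3 : 0 < u t + 1 := lt_of_lt_of_le (by positivity) h1
    rw [Real.log_div h3.ne' h2.ne', add_comm 1]
    ring
  have b1 : |Real.log (-(u' t / t ^ (γ - 1))) - Real.log (-(u' s / s ^ (γ - 1)))| ≤
      K * γ / r * H := by
    have hl : ∀ {t}, t ∈ Ioo (0:ℝ) 1 → r / γ ≤ -(u' t / t ^ (γ - 1)) := by
      intro t ht
      have hp := Real.rpow_pos_of_pos ht.1 (γ - 1)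
      rw [← neg_div, le_div_iff₀ hp]
      refine le_trans ?_ (h.lower t ht)
      gcongr
      exact div_le_self hr.le hγ.le
    refine (abs_log_sub_log_le hrg (hl ht) (hl hs)).trans ?_
    rw [neg_sub_neg, abs_sub_comm, div_le_iff₀ hrg]
    refine (h.holder_ratio t ht s hs).trans (le_of_eq ?_)
    field_simp
    rw [hH]
  have b2 : |Real.log ((1 + ε - u t) / t ^ γ) - Real.log ((1 + ε - u s) / s ^ γ)| ≤
      K * γ / r * H := by
    have hl : ∀ {t}, t ∈ Ioo (0:ℝ) 1 → r / γ ≤ (1 + ε - u t) / t ^ γ := by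
      intro t ht
      rw [le_div_iff₀ (Real.rpow_pos_of_pos ht.1 _)]
      exact h.top_sub_ge ht
    refine (abs_log_sub_log_le hrg (hl ht) (hl hs)).trans ?_
    rw [div_le_iff₀ hrg]
    refine (h.top_quotient_holder ht hs).trans (le_of_eq ?_)
    field_simp
    rw [hH]
  have b3 : |Real.log ((u t + 1) / (1 - t)) - Real.log ((u s + 1) / (1 - s))| ≤
      K * γ / r * H := by
    have hl : ∀ {t}, t ∈ Ioo (0:ℝ) 1 → r / γ ≤ (u t + 1) / (1 - t) := by
      intro t ht
      rw [le_div_iff₀ (by linarith [ht.2])]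
      exact h.add_one_ge ht
    refine (abs_log_sub_log_le hrg (hl ht) (hl hs)).trans ?_
    rw [div_le_iff₀ hrg]
    refine (h.bot_quotient_holder ht hs).trans (le_of_eq ?_)
    field_simp
    rw [hH]
  have b4 : |Real.log (1 + t) - Real.log (1 + s)| ≤ H := by
    refine (abs_log_sub_log_le zero_lt_one (by linarith [ht.1]) (by linarith [hs.1])).trans ?_
    rw [add_sub_add_left_eq_sub, div_one]
    rcases (abs_nonneg (t - s)).eq_or_lt with h0 | h0
    · rw [← h0]; exact hH0
    · have : |t - s| ≤ 1 := by
        rw [abs_le]; constructor <;> linarith [ht.1, ht.2, hs.1, hs.2]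
      simpa using Real.rpow_le_rpow_of_exponent_ge h0 this h.α_mem.2
  have b5 : |Real.log (ε + (1 - u t)) - Real.log (ε + (1 - u s))| ≤
      |Real.log (1 - u t) - Real.log (1 - u s)| :=
    abs_log_add_sub_log_add_le h.ε_nonneg (by linarith) (by linarith)
  have c1 : |Real.log (u' t) - Real.log (u' s)| ≤ K * γ / r * H +
      (1 - 1 / γ) * (|Real.log (1 - u t) - Real.log (1 - u s)| + K * γ / r * H) := by
    rw [e1 ht hut, e1 hs hus]
    have hx : |(Real.log (ε + (1 - u t)) - Real.log ((1 + ε - u t) / t ^ γ)) -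
        (Real.log (ε + (1 - u s)) - Real.log ((1 + ε - u s) / s ^ γ))| ≤
        |Real.log (1 - u t) - Real.log (1 - u s)| + K * γ / r * H := by
      rw [sub_sub_sub_comm]
      exact (abs_sub _ _).trans (add_le_add b5 b2)
    rw [add_sub_add_comm, ← mul_sub]
    refine (abs_add_le _ _).trans (add_le_add b1 ?_)
    rw [abs_mul, abs_of_nonneg hκ0]
    gcongr
  have c2 : |Real.log (1 - t) - Real.log (1 - s)| ≤
      |Real.log (1 + u t) - Real.log (1 + u s)| + K * γ / r * H := by
    rw [e2 ht, e2 hs, sub_sub_sub_comm]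
    exact (abs_sub _ _).trans (add_le_add le_rfl b3)
  have hKH : 0 ≤ K * γ / r * H := by positivity
  have d1 := mul_le_mul_of_nonneg_left (add_le_add c2 b4) hκ0
  have d2 : (1 - 1 / γ) * (K * γ / r * H) ≤ K * γ / r * H :=
    mul_le_of_le_one_left hKH hκ1
  have d3 : (1 - 1 / γ) * H ≤ H := mul_le_of_le_one_left hH0 hκ1
  have d4 : (3 * K * γ / r + 1) * H = 3 * (K * γ / r * H) + H := by ring
  rw [d4]
  linarith

end FoldedBranch

/-- The sign of the side of the turning point on which a branch takes its values. -/
def side : Bool → ℝ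
  | false => -1
  | true => 1

theorem side_mul_side (b : Bool) : side b * side b = 1 := by cases b <;> norm_num [side]

theorem abs_side (b : Bool) : |side b| = 1 := by cases b <;> norm_num [side]

theorem side_mul_mem_Icc (b : Bool) {t : ℝ} (ht : t ∈ Icc (0:ℝ) 1) :
    side b * t ∈ Icc (-1:ℝ) 1 := by
  cases b <;> simp only [side] <;> constructor <;> linarith [ht.1, ht.2]

theorem side_mul_mem_Ioo (b : Bool) {t : ℝ} (ht : t ∈ Ioo (0:ℝ) 1) :
    side b * t ∈ Ioo (-1:ℝ) 1 := by
  cases b <;> simp only [side] <;> constructor <;> linarith [ht.1, ht.2]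

/-- Both sides of the unimodal map `f` are folded branches, with the same constants. -/
def FoldedMap (γ r R K α ε : ℝ) (f f' : ℝ → ℝ) : Prop :=
  ∀ b, FoldedBranch γ r R K α ε (fun t => f (side b * t)) (fun t => side b * f' (side b * t))

namespace GoodFamily

theorem exists_ratio_bounds (F : GoodFamily) (b : Bool) :
    ∃ r > 0, ∃ R, ∀ ε ∈ Icc 0 F.eps0, ∀ t ∈ Ioo (0:ℝ) 1,
      r * t ^ (F.gamma - 1) ≤ |F.f' ε (side b * t)| ∧
      |F.f' ε (side b * t)| ≤ R * t ^ (F.gamma - 1) := by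
  have key : ∀ (G : ℝ → ℝ → ℝ) (c d : ℝ), c ≤ d →
      ContinuousOn (fun p : ℝ × ℝ => G p.1 p.2) (Icc 0 F.eps0 ×ˢ Icc c d) →
      (∀ ε ∈ Icc 0 F.eps0, ∀ x ∈ Icc c d, G ε x ≠ 0) →
      ∃ r > 0, ∃ R, ∀ ε ∈ Icc 0 F.eps0, ∀ x ∈ Icc c d, r ≤ |G ε x| ∧ |G ε x| ≤ R := by
    intro G c d hcd hG hne
    have hc : IsCompact (Icc 0 F.eps0 ×ˢ Icc c d) := isCompact_Icc.prod isCompact_Icc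
    have hn : (Icc 0 F.eps0 ×ˢ Icc c d).Nonempty :=
      (nonempty_Icc.2 F.eps0_pos.le).prod (nonempty_Icc.2 hcd)
    obtain ⟨p, hp, hmin⟩ := hc.exists_isMinOn hn hG.abs
    obtain ⟨q, hq, hmax⟩ := hc.exists_isMaxOn hn hG.abs
    exact ⟨|G p.1 p.2|, abs_pos.2 (hne _ hp.1 _ hp.2), |G q.1 q.2|, fun ε hε x hx =>
      ⟨hmin (mk_mem_prod hε hx), hmax (mk_mem_prod hε hx)⟩⟩
  have fin : ∀ {r R G y t : ℝ}, 0 < t → G = y / t ^ (F.gamma - 1) → r ≤ |G| ∧ |G| ≤ R →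
      r * t ^ (F.gamma - 1) ≤ |y| ∧ |y| ≤ R * t ^ (F.gamma - 1) := by
    intro r R G y t ht hG hr
    have hp := Real.rpow_pos_of_pos ht (F.gamma - 1)
    rw [hG, abs_div, abs_of_pos hp, le_div_iff₀ hp, div_le_iff₀ hp] at hr
    exact hr
  cases b
  · obtain ⟨r, hr, R, hR⟩ := key F.Rneg (-1) 0 (by norm_num) F.Rneg_cont F.Rneg_ne
    refine ⟨r, hr, R, fun ε hε t ht => fin ht.1 ?_ (hR ε hε (side false * t) ?_)⟩
    · rw [F.Rneg_eq ε hε _ ⟨by simp [side, ht.2.le], by simp [side, ht.1]⟩]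
      simp [side, abs_of_pos ht.1]
    · exact ⟨by simp [side, ht.2.le], by simp [side, ht.1.le]⟩
  · obtain ⟨r, hr, R, hR⟩ := key F.Rpos 0 1 (by norm_num) F.Rpos_cont F.Rpos_ne
    refine ⟨r, hr, R, fun ε hε t ht => fin ht.1 ?_ (hR ε hε (side true * t) ?_)⟩
    · rw [F.Rpos_eq ε hε _ ⟨by simp [side, ht.1], by simp [side, ht.2.le]⟩]
      simp [side, abs_of_pos ht.1]
    · exact ⟨by simp [side, ht.1.le], by simp [side, ht.2.le]⟩

theorem side_mul_deriv_nonpos (F : GoodFamily) {ε : ℝ} (hε : ε ∈ Icc 0 F.eps0) (b : Bool) {t : ℝ}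
    (ht : t ∈ Ioo (0:ℝ) 1) : side b * F.f' ε (side b * t) ≤ 0 := by
  have hd := F.deriv_f ε hε _ (side_mul_mem_Icc b ⟨ht.1.le, ht.2.le⟩)
  cases b
  · have hm : side false * t ∈ Icc (-1:ℝ) 0 := ⟨by simp [side, ht.2.le], by simp [side, ht.1.le]⟩
    have h1 := hd.mono (Icc_subset_Icc_right zero_le_one : Icc (-1:ℝ) 0 ⊆ Icc (-1) 1)
    have h2 := (F.mono ε hε).monotoneOn.derivWithin_nonneg (x := side false * t)
    rw [h1.derivWithin ((uniqueDiffOn_Icc (by norm_num)) _ hm)] at h2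
    simp only [side] at h2 ⊢
    linarith
  · have hm : side true * t ∈ Icc (0:ℝ) 1 := ⟨by simp [side, ht.1.le], by simp [side, ht.2.le]⟩
    have h1 := hd.mono (Icc_subset_Icc_left (by norm_num) : Icc (0:ℝ) 1 ⊆ Icc (-1) 1)
    have h2 := (F.anti ε hε).antitoneOn.derivWithin_nonpos (x := side true * t)
    rw [h1.derivWithin ((uniqueDiffOn_Icc (by norm_num)) _ hm)] at h2
    simp only [side] at h2 ⊢
    linarith

theorem exists_foldedMap (F : GoodFamily) : ∃ r R K α, ∀ ε ∈ Icc 0 F.eps0,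
    FoldedMap F.gamma r R K α ε (F.f ε) (F.f' ε) := by
  choose r hr R hR using F.exists_ratio_bounds
  refine ⟨min (r false) (r true), max (R false) (R true), max F.K' F.K'',
    min F.alpha' F.alpha'', fun ε hε b => ?_⟩
  have hside : ∀ t ∈ Ioo (0:ℝ) 1, -(side b * F.f' ε (side b * t)) = |F.f' ε (side b * t)| := by
    intro t ht
    rw [← abs_of_nonpos (F.side_mul_deriv_nonpos hε b ht), abs_mul, abs_side, one_mul]
  have hrb : min (r false) (r true) ≤ r b := by cases b <;> simp
  have hRb : R b ≤ max (R false) (R true) := by cases b <;> simp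
  have hdist : ∀ t s : ℝ, |side b * t - side b * s| = |t - s| := by
    intro t s
    rw [← mul_sub, abs_mul, abs_side, one_mul]
  have hhol : ∀ {K₁ a₁ : ℝ}, 0 < K₁ → 0 < a₁ → K₁ ≤ max F.K' F.K'' →
      min F.alpha' F.alpha'' ≤ a₁ → ∀ t ∈ Ioo (0:ℝ) 1, ∀ s ∈ Ioo (0:ℝ) 1,
      K₁ * |t - s| ^ a₁ ≤ max F.K' F.K'' * |t - s| ^ min F.alpha' F.alpha'' := by
    intro K₁ a₁ hK ha hK' ha' t ht s hs
    have hle : |t - s| ≤ 1 := by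
      rw [abs_le]; constructor <;> linarith [ht.1, ht.2, hs.1, hs.2]
    refine mul_le_mul hK' ?_ (by positivity) (hK.le.trans hK')
    rcases (abs_nonneg (t - s)).eq_or_lt with h0 | h0
    · rw [← h0, Real.zero_rpow ha.ne']; positivity
    · exact Real.rpow_le_rpow_of_exponent_ge h0 hle ha'
  refine
    { one_lt := F.one_lt_gamma
      r_pos := lt_min (hr _) (hr _)
      K_nonneg := F.K'_pos.le.trans (le_max_left _ _)
      α_mem := ⟨lt_min F.alpha'_mem.1 F.alpha''_mem.1, (min_le_left _ _).trans F.alpha'_mem.2⟩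
      ε_nonneg := hε.1
      cont := ?_, hasDeriv := ?_, map_zero := ?_, map_one := ?_, lower := ?_, upper := ?_
      holder := ?_, holder_ratio := ?_ }
  · have hc : ContinuousOn (F.f ε) (Icc (-1) 1) :=
      fun x hx => (F.deriv_f ε hε x hx).continuousWithinAt
    exact hc.comp (by fun_prop) (fun t ht => side_mul_mem_Icc b ht)
  · intro t ht
    have hm := side_mul_mem_Ioo b ht
    have h1 := (F.deriv_f ε hε _ (Ioo_subset_Icc_self hm)).hasDerivAt (Icc_mem_nhds hm.1 hm.2)
    have h2 : HasDerivAt (fun t => side b * t) (side b) t := by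
      simpa using (hasDerivAt_id t).const_mul (side b)
    exact (h1.comp t h2).congr_deriv (mul_comm _ _)
  · simp [F.map_zero ε hε]
  · cases b
    · simp [side, F.map_neg_one ε hε]
    · simp [side, F.map_one ε hε]
  · intro t ht
    rw [hside t ht]
    have := Real.rpow_nonneg ht.1.le (F.gamma - 1)
    exact (mul_le_mul_of_nonneg_right hrb this).trans (hR b ε hε t ht).1
  · intro t ht
    rw [hside t ht]
    have := Real.rpow_nonneg ht.1.le (F.gamma - 1)
    exact (hR b ε hε t ht).2.trans (mul_le_mul_of_nonneg_right hRb this)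
  · intro t ht s hs
    rw [← mul_sub, abs_mul, abs_side, one_mul]
    refine le_trans ?_ (hhol F.K'_pos F.alpha'_mem.1 (le_max_left _ _) (min_le_left _ _) t ht s hs)
    have := F.holder' ε hε _ (Ioo_subset_Icc_self (side_mul_mem_Ioo b ht)) _
      (Ioo_subset_Icc_self (side_mul_mem_Ioo b hs))
    rwa [hdist] at this
  · intro t ht s hs
    refine le_trans ?_
      (hhol F.K''_pos F.alpha''_mem.1 (le_max_right _ _) (min_le_right _ _) t ht s hs)
    rw [mul_div_assoc, mul_div_assoc, ← mul_sub, abs_mul, abs_side, one_mul]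
    have habs : ∀ {t : ℝ}, t ∈ Ioo (0:ℝ) 1 → |side b * t| = t := by
      intro t ht
      rw [abs_mul, abs_side, one_mul, abs_of_pos ht.1]
    have : |F.f' ε (side b * t) / |side b * t| ^ (F.gamma - 1) -
        F.f' ε (side b * s) / |side b * s| ^ (F.gamma - 1)| ≤
        F.K'' * |side b * t - side b * s| ^ F.alpha'' := by
      cases b
      · refine F.holder''_neg ε hε _ ⟨?_, ?_⟩ _ ⟨?_, ?_⟩ <;> simp only [side] <;>
          linarith [ht.1, ht.2, hs.1, hs.2]
      · refine F.holder''_pos ε hε _ ⟨?_, ?_⟩ _ ⟨?_, ?_⟩ <;> simp only [side] <;>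
          linarith [ht.1, ht.2, hs.1, hs.2]
    rwa [hdist, habs ht, habs hs] at this

end GoodFamily

theorem continuousOn_invFunOn_image {X Y : Type*} [TopologicalSpace X] [TopologicalSpace Y]
    [T2Space Y] [Nonempty X] {g : X → Y} {s : Set X} (hs : IsCompact s) (hg : ContinuousOn g s)
    (hinj : InjOn g s) : ContinuousOn (Function.invFunOn g s) (g '' s) := by
  rw [continuousOn_iff_isClosed]
  intro t ht
  refine ⟨g '' (s ∩ t), ((hs.inter_right ht).image_of_continuousOn
    (hg.mono inter_subset_left)).isClosed, ?_⟩
  ext y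
  constructor
  · rintro ⟨hy, x, hx, rfl⟩
    rw [mem_preimage, hinj.leftInvOn_invFunOn hx] at hy
    exact ⟨⟨x, ⟨hx, hy⟩, rfl⟩, x, hx, rfl⟩
  · rintro ⟨⟨x, ⟨hx, hxt⟩, rfl⟩, -⟩
    refine ⟨?_, x, hx, rfl⟩
    rwa [mem_preimage, hinj.leftInvOn_invFunOn hx]

/-- The closed half of `[-1, 1]` in which a branch takes its values. -/
def half (b : Bool) : Set ℝ := (fun t => side b * t) '' Icc 0 1

theorem half_false : half false = Icc (-1) 0 := by
  ext x
  simp only [half, side, mem_image, mem_Icc]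
  exact ⟨by rintro ⟨t, ht, rfl⟩; constructor <;> linarith [ht.1, ht.2],
    fun hx => ⟨-x, by constructor <;> linarith [hx.1, hx.2], by ring⟩⟩

theorem half_true : half true = Icc 0 1 := by
  simp [half, side]

theorem branch_eq_invFunOn (f : ℝ → ℝ) (b : Bool) : branch f b = Function.invFunOn f (half b) := by
  cases b
  · rw [half_false]; rfl
  · rw [half_true]; rfl

namespace FoldedMap

variable {γ r R K α ε : ℝ} {f f' : ℝ → ℝ}

theorem strictAntiOn (h : FoldedMap γ r R K α ε f f') (b : Bool) :
    StrictAntiOn (fun t => f (side b * t)) (Icc 0 1) := by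
  intro s hs t ht hst
  have h1 := (h b).sub_ge hs.1 hst ht.2
  have h2 := Real.rpow_lt_rpow hs.1 hst (by linarith [(h b).one_lt] : 0 < γ)
  have h3 : 0 < r / γ := div_pos (h b).r_pos (by linarith [(h b).one_lt])
  have := mul_pos h3 (sub_pos.2 h2)
  simp only at h1 ⊢
  linarith

theorem injOn_half (h : FoldedMap γ r R K α ε f f') (b : Bool) : InjOn f (half b) := by
  rintro _ ⟨s, hs, rfl⟩ _ ⟨t, ht, rfl⟩ hst
  rw [(h.strictAntiOn b).injOn hs ht hst]

theorem image_half (h : FoldedMap γ r R K α ε f f') (b : Bool) :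
    f '' half b = Icc (-1) (1 + ε) := by
  rw [half, ← image_comp]
  apply Subset.antisymm
  · rintro _ ⟨t, ht, rfl⟩
    have h0 := (h.strictAntiOn b).antitoneOn ⟨le_rfl, zero_le_one⟩ ht ht.1
    have h1 := (h.strictAntiOn b).antitoneOn ht ⟨zero_le_one, le_rfl⟩ ht.2
    rw [(h b).map_zero] at h0
    rw [(h b).map_one] at h1
    exact ⟨h1, h0⟩
  · have := intermediate_value_Icc' zero_le_one (h b).cont
    rwa [(h b).map_zero, (h b).map_one] at this

theorem continuousOn_half (h : FoldedMap γ r R K α ε f f') (b : Bool) :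
    ContinuousOn f (half b) := by
  have h1 : ContinuousOn (fun x => f (side b * (side b * x))) (half b) := by
    refine (h b).cont.comp (by fun_prop : ContinuousOn (fun x => side b * x) (half b)) ?_
    rintro _ ⟨t, ht, rfl⟩
    simpa [← mul_assoc, side_mul_side] using ht
  simpa [← mul_assoc, side_mul_side] using h1

theorem continuousOn_branch (h : FoldedMap γ r R K α ε f f') (b : Bool) :
    ContinuousOn (branch f b) (Icc (-1) (1 + ε)) := by
  rw [branch_eq_invFunOn, ← h.image_half b]
  exact continuousOn_invFunOn_image (isCompact_Icc.image (by fun_prop)) (h.continuousOn_half b)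
    (h.injOn_half b)

theorem apply_branch (h : FoldedMap γ r R K α ε f f') (b : Bool) {x : ℝ}
    (hx : x ∈ Icc (-1) (1 + ε)) : f (branch f b x) = x := by
  rw [← h.image_half b] at hx
  rw [branch_eq_invFunOn]
  exact Function.invFunOn_eq hx

theorem branch_apply (h : FoldedMap γ r R K α ε f f') (b : Bool) {t : ℝ} (ht : t ∈ Icc (0:ℝ) 1) :
    branch f b (f (side b * t)) = side b * t := by
  rw [branch_eq_invFunOn]
  exact (h.injOn_half b).leftInvOn_invFunOn (mem_image_of_mem _ ht)

theorem exists_branch_eq (h : FoldedMap γ r R K α ε f f') (b : Bool) {x : ℝ}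
    (hx : x ∈ Icc (-1) (1 + ε)) :
    ∃ t ∈ Icc (0:ℝ) 1, branch f b x = side b * t ∧ f (side b * t) = x := by
  have hx' := hx
  rw [← h.image_half b] at hx'
  obtain ⟨_, ⟨t, ht, rfl⟩, rfl⟩ := hx'
  exact ⟨t, ht, h.branch_apply b ht, rfl⟩

theorem Icc_subset (h : FoldedMap γ r R K α ε f f') : Icc (-1:ℝ) 1 ⊆ Icc (-1) (1 + ε) :=
  Icc_subset_Icc_right (by linarith [(h true).ε_nonneg])

theorem exists_branch_eq_Ioo (h : FoldedMap γ r R K α ε f f') (b : Bool) {x : ℝ}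
    (hx : x ∈ Ioo (-1:ℝ) (1 + ε)) :
    ∃ t ∈ Ioo (0:ℝ) 1, branch f b x = side b * t ∧ f (side b * t) = x := by
  obtain ⟨t, ht, h1, h2⟩ := h.exists_branch_eq b (Ioo_subset_Icc_self hx)
  refine ⟨t, ⟨ht.1.lt_of_ne ?_, ht.2.lt_of_ne ?_⟩, h1, h2⟩
  · rintro rfl
    have := (h b).map_zero
    simp only [h2] at this
    linarith [hx.2]
  · rintro rfl
    have := (h b).map_one
    simp only [h2] at this
    linarith [hx.1]

theorem deriv_ne_zero (h : FoldedMap γ r R K α ε f f') (b : Bool) {t : ℝ}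
    (ht : t ∈ Ioo (0:ℝ) 1) : f' (side b * t) ≠ 0 := by
  intro h0
  have := (h b).lower t ht
  have := mul_pos (h b).r_pos (Real.rpow_pos_of_pos ht.1 (γ - 1))
  simp only [h0] at *
  linarith

theorem hasDerivAt_branch (h : FoldedMap γ r R K α ε f f') (b : Bool) {x : ℝ}
    (hx : x ∈ Ioo (-1:ℝ) 1) : HasDerivAt (branch f b) (f' (branch f b x))⁻¹ x := by
  have hx' : x ∈ Ioo (-1:ℝ) (1 + ε) := ⟨hx.1, by linarith [hx.2, (h b).ε_nonneg]⟩
  obtain ⟨t, ht, h1, h2⟩ := h.exists_branch_eq_Ioo b hx'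
  have hd : HasDerivAt f (f' (side b * t)) (side b * t) := by
    have e : side b * (side b * t) = t := by rw [← mul_assoc, side_mul_side, one_mul]
    have h3 : HasDerivAt (fun x => side b * x) (side b) (side b * t) := by
      simpa using (hasDerivAt_id (side b * t)).const_mul (side b)
    have h5 : HasDerivAt (fun t => f (side b * t)) (side b * f' (side b * t))
        (side b * (side b * t)) := by
      rw [e]; exact (h b).hasDeriv t ht
    have h4 := h5.comp (side b * t) h3
    rw [mul_right_comm, side_mul_side, one_mul] at h4
    refine h4.congr_of_eventuallyEq (Eventually.of_forall fun x => ?_)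
    simp [← mul_assoc, side_mul_side]
  have hn : Icc (-1) (1 + ε) ∈ 𝓝 x := Icc_mem_nhds hx'.1 hx'.2
  have hd' : HasDerivAt f (f' (branch f b x)) (branch f b x) := by rwa [h1]
  refine hd'.of_local_left_inverse ((h.continuousOn_branch b).continuousAt hn) ?_ ?_
  · rw [h1]; exact h.deriv_ne_zero b ht
  · filter_upwards [hn] with y hy using h.apply_branch b hy

theorem mapsTo_branch (h : FoldedMap γ r R K α ε f f') (b : Bool) :
    MapsTo (branch f b) (Icc (-1) 1) (Icc (-1) 1) := by
  intro x hx
  obtain ⟨t, ht, h1, -⟩ := h.exists_branch_eq b (h.Icc_subset hx)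
  rw [h1]
  exact side_mul_mem_Icc b ht

theorem mapsTo_gw (h : FoldedMap γ r R K α ε f f') (w : List Bool) :
    MapsTo (gw f w) (Icc (-1) 1) (Icc (-1) 1) := by
  induction w with
  | nil => exact mapsTo_id _
  | cons b w ih => exact (h.mapsTo_branch b).comp ih

theorem mapsTo_gw_Ioo (h : FoldedMap γ r R K α ε f f') (w : List Bool) :
    MapsTo (gw f w) (Ioo (-1) 1) (Ioo (-1) 1) := by
  induction w with
  | nil => exact mapsTo_id _
  | cons b w ih =>
    refine MapsTo.comp (fun x hx => ?_) ih
    obtain ⟨t, ht, h1, -⟩ := h.exists_branch_eq_Ioo b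
      (Ioo_subset_Ioo_right (by linarith [(h b).ε_nonneg]) hx)
    rw [h1]
    exact side_mul_mem_Ioo b ht

theorem continuousOn_gw (h : FoldedMap γ r R K α ε f f') (w : List Bool) :
    ContinuousOn (gw f w) (Icc (-1) 1) := by
  induction w with
  | nil => exact continuousOn_id
  | cons b w ih => exact ((h.continuousOn_branch b).mono h.Icc_subset).comp ih (h.mapsTo_gw w)

theorem injOn_gw (h : FoldedMap γ r R K α ε f f') (w : List Bool) :
    InjOn (gw f w) (Icc (-1) 1) := by
  induction w with
  | nil => exact injOn_id _
  | cons b w ih =>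
    refine InjOn.comp (fun x hx y hy hxy => ?_) ih (h.mapsTo_gw w)
    rw [← h.apply_branch b (h.Icc_subset hx), hxy, h.apply_branch b (h.Icc_subset hy)]

theorem strictMonoOn_or_strictAntiOn_gw (h : FoldedMap γ r R K α ε f f') (w : List Bool) :
    StrictMonoOn (gw f w) (Icc (-1) 1) ∨ StrictAntiOn (gw f w) (Icc (-1) 1) :=
  (h.continuousOn_gw w).strictMonoOn_of_injOn_Icc' (by norm_num) (h.injOn_gw w)

theorem len_image_gw (h : FoldedMap γ r R K α ε f f') (w : List Bool) {a b : ℝ}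
    (ha : -1 ≤ a) (hab : a ≤ b) (hb : b ≤ 1) :
    len (gw f w '' Icc a b) = |gw f w b - gw f w a| := by
  have hsub : Icc a b ⊆ Icc (-1:ℝ) 1 := Icc_subset_Icc ha hb
  have hc := (h.continuousOn_gw w).mono hsub
  have hl : a ∈ Icc a b := ⟨le_rfl, hab⟩
  have hr : b ∈ Icc a b := ⟨hab, le_rfl⟩
  rcases h.strictMonoOn_or_strictAntiOn_gw w with hm | hm
  · have hm := (hm.mono hsub).monotoneOn
    rw [Subset.antisymm hm.image_Icc_subset (intermediate_value_Icc hab hc), len, Real.volume_Icc,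
      ENNReal.toReal_ofReal (sub_nonneg.2 (hm hl hr hab)),
      abs_of_nonneg (sub_nonneg.2 (hm hl hr hab))]
  · have hm := (hm.mono hsub).antitoneOn
    rw [Subset.antisymm hm.image_Icc_subset (intermediate_value_Icc' hab hc), len, Real.volume_Icc,
      ENNReal.toReal_ofReal (sub_nonneg.2 (hm hl hr hab)), abs_sub_comm,
      abs_of_nonneg (sub_nonneg.2 (hm hl hr hab))]

theorem abs_sub_le_len (h : FoldedMap γ r R K α ε f f') (w : List Bool) {x y : ℝ}
    (hx : x ∈ Icc (-1:ℝ) 1) (hy : y ∈ Icc (-1:ℝ) 1) :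
    |gw f w x - gw f w y| ≤ len (Iw f w) := by
  wlog hxy : y ≤ x generalizing x y
  · rw [abs_sub_comm]; exact this hy hx (le_of_not_ge hxy)
  rw [← h.len_image_gw w hy.1 hxy hx.2, Iw, len, len]
  refine ENNReal.toReal_mono ?_ (measure_mono (image_mono (Icc_subset_Icc hy.1 hx.2)))
  exact (isCompact_Icc.image_of_continuousOn (h.continuousOn_gw w)).measure_lt_top.ne

end FoldedMap

/-- The sum of the logarithmic distances between `x` and `y` measured from the endpoints `±1`. -/
noncomputable def endpointLogDist (x y : ℝ) : ℝ :=
  |Real.log (1 - x) - Real.log (1 - y)| + |Real.log (1 + x) - Real.log (1 + y)|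

theorem endpointLogDist_nonneg (x y : ℝ) : 0 ≤ endpointLogDist x y := by
  unfold endpointLogDist; positivity

theorem endpointLogDist_side_mul (b : Bool) (t s : ℝ) :
    endpointLogDist (side b * t) (side b * s) = endpointLogDist t s := by
  cases b
  · simp only [endpointLogDist, side, neg_one_mul, sub_neg_eq_add, ← sub_eq_add_neg]
    exact add_comm _ _
  · simp [side]

namespace FoldedMap

variable {γ r R K α ε : ℝ} {f f' : ℝ → ℝ}

theorem log_distortion_branch (h : FoldedMap γ r R K α ε f f') (b : Bool) {x y : ℝ}
    (hx : x ∈ Ioo (-1:ℝ) 1) (hy : y ∈ Ioo (-1:ℝ) 1) :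
    |Real.log (f' (branch f b x)) - Real.log (f' (branch f b y))| +
        (1 - 1 / γ) * endpointLogDist (branch f b x) (branch f b y) ≤
      (1 - 1 / γ) * endpointLogDist x y +
        (3 * K * γ / r + 1) * |branch f b x - branch f b y| ^ α := by
  have hsub : Ioo (-1:ℝ) 1 ⊆ Ioo (-1) (1 + ε) :=
    Ioo_subset_Ioo_right (by linarith [(h b).ε_nonneg])
  obtain ⟨t, ht, h1, h2⟩ := h.exists_branch_eq_Ioo b (hsub hx)
  obtain ⟨s, hs, h3, h4⟩ := h.exists_branch_eq_Ioo b (hsub hy)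
  have key := (h b).log_distortion ht hs (by simpa only [h2] using hx.2)
    (by simpa only [h4] using hy.2)
  have hlog : ∀ z, Real.log (side b * z) = Real.log z := by
    intro z
    cases b <;> simp [side]
  rw [h1, h3, endpointLogDist_side_mul, ← mul_sub (side b), abs_mul (side b), abs_side, one_mul]
  simpa only [hlog, h2, h4, endpointLogDist] using key

theorem exists_hasDerivAt_gw (h : FoldedMap γ r R K α ε f f') {C l : ℝ} (hl : 0 ≤ l)
    (hC : 0 ≤ C) (hdecay : ∀ b w, len (Iw f (b :: w)) ≤ C * l ^ w.length) (w : List Bool) :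
    ∃ P : ℝ → ℝ, (∀ x ∈ Ioo (-1:ℝ) 1, HasDerivAt (gw f w) (P x) x ∧ P x ≠ 0) ∧
      ∀ x ∈ Ioo (-1:ℝ) 1, ∀ y ∈ Ioo (-1:ℝ) 1,
        |Real.log (P x) - Real.log (P y)| +
            (1 - 1 / γ) * endpointLogDist (gw f w x) (gw f w y) ≤
          (1 - 1 / γ) * endpointLogDist x y +
            (3 * K * γ / r + 1) * C ^ α * ∑ i ∈ Finset.range w.length, (l ^ α) ^ i := by
  induction w with
  | nil =>
    refine ⟨fun _ => 1, fun x _ => ⟨hasDerivAt_id x, one_ne_zero⟩, fun x _ y _ => ?_⟩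
    simp [gw]
  | cons b w ih =>
    obtain ⟨P, hP, hPl⟩ := ih
    have hb : ∀ x ∈ Ioo (-1:ℝ) 1, f' (branch f b (gw f w x)) ≠ 0 := by
      intro x hx
      have hm := h.mapsTo_gw_Ioo w hx
      obtain ⟨t, ht, h1, -⟩ := h.exists_branch_eq_Ioo b
        (Ioo_subset_Ioo_right (by linarith [(h b).ε_nonneg]) hm)
      rw [h1]
      exact h.deriv_ne_zero b ht
    refine ⟨fun x => (f' (branch f b (gw f w x)))⁻¹ * P x, fun x hx => ⟨?_, ?_⟩,
      fun x hx y hy => ?_⟩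
    · exact (h.hasDerivAt_branch b (h.mapsTo_gw_Ioo w hx)).comp x (hP x hx).1
    · exact mul_ne_zero (inv_ne_zero (hb x hx)) (hP x hx).2
    · have h1 := hPl x hx y hy
      have h2 := h.log_distortion_branch b (h.mapsTo_gw_Ioo w hx) (h.mapsTo_gw_Ioo w hy)
      have hα := (h b).α_mem.1
      have h3 : |branch f b (gw f w x) - branch f b (gw f w y)| ^ α ≤
          C ^ α * (l ^ α) ^ w.length := by
        have e : C ^ α * (l ^ α) ^ w.length = (C * l ^ w.length) ^ α := by
          rw [Real.mul_rpow hC (by positivity), Real.rpow_pow_comm hl]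
        rw [e]
        refine Real.rpow_le_rpow (abs_nonneg _) ?_ hα.le
        exact (h.abs_sub_le_len (b :: w) (Ioo_subset_Icc_self hx)
          (Ioo_subset_Icc_self hy)).trans (hdecay b w)
      have hc : 0 ≤ 3 * K * γ / r + 1 := by
        have := (h b).K_nonneg
        have := (h b).r_pos
        have := (h b).one_lt
        positivity
      have h4 := mul_le_mul_of_nonneg_left h3 hc
      rw [Real.log_mul (inv_ne_zero (hb x hx)) (hP x hx).2,
        Real.log_mul (inv_ne_zero (hb y hy)) (hP y hy).2, Real.log_inv, Real.log_inv,
        List.length_cons, Finset.sum_range_succ]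
      have h5 : |(-Real.log (f' (branch f b (gw f w x))) + Real.log (P x)) -
          (-Real.log (f' (branch f b (gw f w y))) + Real.log (P y))| ≤
          |Real.log (f' (branch f b (gw f w x))) - Real.log (f' (branch f b (gw f w y)))| +
          |Real.log (P x) - Real.log (P y)| := by
        rw [add_sub_add_comm, neg_sub_neg, abs_sub_comm (Real.log (f' (branch f b (gw f w x))))]
        exact abs_add_le _ _
      simp only [gw, Function.comp_apply]
      linarith

theorem exists_hasDerivAt_gw_distortion (h : FoldedMap γ r R K α ε f f') {C l : ℝ} (hl : 0 ≤ l)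
    (hl' : l < 1) (hC : 0 ≤ C) (hdecay : ∀ b w, len (Iw f (b :: w)) ≤ C * l ^ w.length)
    (w : List Bool) :
    ∃ P : ℝ → ℝ, (∀ x ∈ Ioo (-1:ℝ) 1, HasDerivAt (gw f w) (P x) x ∧ P x ≠ 0) ∧
      ∀ x ∈ Ioo (-1:ℝ) 1, ∀ y ∈ Ioo (-1:ℝ) 1,
        |Real.log (P x) - Real.log (P y)| ≤ (1 - 1 / γ) * endpointLogDist x y +
          (3 * K * γ / r + 1) * C ^ α * (1 - l ^ α)⁻¹ := by
  obtain ⟨P, hP, hPl⟩ := h.exists_hasDerivAt_gw hl hC hdecay w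
  refine ⟨P, hP, fun x hx y hy => ?_⟩
  have := hPl x hx y hy
  have hγ := (h true).one_lt
  have hκ : 0 ≤ 1 - 1 / γ := by
    rw [sub_nonneg, div_le_one (by linarith)]; exact hγ.le
  have h1 := mul_nonneg hκ (endpointLogDist_nonneg (gw f w x) (gw f w y))
  have hl0 : 0 ≤ l ^ α := Real.rpow_nonneg hl α
  have hl1 : l ^ α < 1 := Real.rpow_lt_one hl hl' (h true).α_mem.1
  have h2 : ∑ i ∈ Finset.range w.length, (l ^ α) ^ i ≤ (1 - l ^ α)⁻¹ := by
    rw [← tsum_geometric_of_lt_one hl0 hl1]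
    exact (summable_geometric_of_lt_one hl0 hl1).sum_le_tsum _ (fun _ _ => by positivity)
  have hc : 0 ≤ (3 * K * γ / r + 1) * C ^ α := by
    have := (h true).K_nonneg
    have := (h true).r_pos
    positivity
  have h3 := mul_le_mul_of_nonneg_left h2 hc
  linarith

end FoldedMap

/-- `P` is a nonvanishing derivative of `G` on `(-1, 1)` whose logarithmic distortion is
controlled by the logarithmic distances to `±1`. -/
structure EndpointDistortion (γ A : ℝ) (G P : ℝ → ℝ) : Prop where
  one_lt : 1 < γ
  cont : ContinuousOn G (Icc (-1) 1)
  hasDeriv : ∀ x ∈ Ioo (-1:ℝ) 1, HasDerivAt G (P x) x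
  ne_zero : ∀ x ∈ Ioo (-1:ℝ) 1, P x ≠ 0
  distortion : ∀ x ∈ Ioo (-1:ℝ) 1, ∀ y ∈ Ioo (-1:ℝ) 1,
    |Real.log (P x) - Real.log (P y)| ≤ (1 - 1 / γ) * endpointLogDist x y + A

namespace EndpointDistortion

variable {γ A : ℝ} {G P : ℝ → ℝ}

theorem abs_deriv_le (h : EndpointDistortion γ A G P) {x y : ℝ} (hx : x ∈ Ioo (-1:ℝ) 1)
    (hy : y ∈ Ioo (-1:ℝ) 1) :
    |P x| ≤ Real.exp ((1 - 1 / γ) * endpointLogDist x y + A) * |P y| := by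
  have h1 := (abs_le.1 (h.distortion x hx y hy)).2
  rw [← Real.exp_log (abs_pos.2 (h.ne_zero x hx)), ← Real.exp_log (abs_pos.2 (h.ne_zero y hy)),
    ← Real.exp_add, Real.exp_le_exp, Real.log_abs, Real.log_abs]
  linarith

theorem endpointLogDist_zero_le {d x : ℝ} (hd : 0 < d) (hx : |x| ≤ 1 - d) :
    endpointLogDist x 0 ≤ 2 / d := by
  have hx' := abs_le.1 hx
  have hd1 : d ≤ 1 := by linarith [abs_nonneg x]
  have h1 := abs_log_sub_log_le hd (by linarith : d ≤ 1 - x) (by linarith : d ≤ 1 - 0)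
  have h2 := abs_log_sub_log_le hd (by linarith : d ≤ 1 + x) (by linarith : d ≤ 1 + 0)
  have h3 : |1 - x - (1 - 0)| / d ≤ 1 / d := by
    gcongr
    rw [show 1 - x - (1 - 0) = -x by ring, abs_neg]
    linarith
  have h4 : |1 + x - (1 + 0)| / d ≤ 1 / d := by
    gcongr
    rw [show 1 + x - (1 + 0) = x by ring]
    linarith
  have h5 : 2 / d = 1 / d + 1 / d := by ring
  unfold endpointLogDist
  linarith

theorem endpointLogDist_comm (x y : ℝ) : endpointLogDist x y = endpointLogDist y x := by
  simp only [endpointLogDist, abs_sub_comm]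

theorem mul_le_of_le_bound (h : EndpointDistortion γ A G P) {D d : ℝ} (hD : 0 ≤ D) (hd : D ≤ d) :
    (1 - 1 / γ) * D + A ≤ d + A := by
  have : 0 < 1 / γ := by have := h.one_lt; positivity
  nlinarith

theorem abs_sub_bounds (h : EndpointDistortion γ A G P) {d p q : ℝ} (hd : 0 < d) (hpq : p < q)
    (hp : -(1 - d) ≤ p) (hq : q ≤ 1 - d) :
    Real.exp (-(2 / d + A)) * |P 0| * (q - p) ≤ |G q - G p| ∧
      |G q - G p| ≤ Real.exp (2 / d + A) * |P 0| * (q - p) := by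
  obtain ⟨c, hc, hc'⟩ := exists_hasDerivAt_eq_slope G P hpq
    (h.cont.mono (Icc_subset_Icc (by linarith) (by linarith)))
    (fun x hx => h.hasDeriv x ⟨by linarith [hx.1], by linarith [hx.2]⟩)
  have hqp : 0 < q - p := sub_pos.2 hpq
  have e : |G q - G p| = |P c| * (q - p) := by
    rw [hc', abs_div, abs_of_pos hqp]
    field_simp
  have hcm : c ∈ Ioo (-1:ℝ) 1 := ⟨by linarith [hc.1], by linarith [hc.2]⟩
  have h0 : (0:ℝ) ∈ Ioo (-1:ℝ) 1 := by norm_num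
  have hcd : endpointLogDist c 0 ≤ 2 / d :=
    endpointLogDist_zero_le hd (abs_le.2 ⟨by linarith [hc.1], by linarith [hc.2]⟩)
  have hB := h.mul_le_of_le_bound (endpointLogDist_nonneg _ _) hcd
  have h1 := h.abs_deriv_le hcm h0
  have h2 := h.abs_deriv_le h0 hcm
  rw [endpointLogDist_comm] at h2
  rw [e]
  constructor
  · refine mul_le_mul_of_nonneg_right ?_ hqp.le
    rw [Real.exp_neg, inv_mul_le_iff₀ (Real.exp_pos _)]
    exact h2.trans (by gcongr)
  · refine mul_le_mul_of_nonneg_right (h1.trans (by gcongr)) hqp.le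

theorem comp_neg (h : EndpointDistortion γ A G P) :
    EndpointDistortion γ A (fun x => G (-x)) (fun x => -P (-x)) where
  one_lt := h.one_lt
  cont := h.cont.comp (by fun_prop) (fun x hx => ⟨by linarith [hx.2], by linarith [hx.1]⟩)
  hasDeriv x hx := by
    have := (h.hasDeriv (-x) ⟨by linarith [hx.2], by linarith [hx.1]⟩).comp x (hasDerivAt_neg x)
    exact this.congr_deriv (by ring)
  ne_zero x hx := neg_ne_zero.2 (h.ne_zero (-x) ⟨by linarith [hx.2], by linarith [hx.1]⟩)
  distortion x hx y hy := by
    have := h.distortion (-x) ⟨by linarith [hx.2], by linarith [hx.1]⟩ (-y)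
      ⟨by linarith [hy.2], by linarith [hy.1]⟩
    have e := endpointLogDist_side_mul false x y
    simp only [side, neg_one_mul] at e
    rw [e] at this
    simpa only [Real.log_neg_eq_log] using this

theorem abs_apply_one_sub_le (h : EndpointDistortion γ A G P) :
    |G 1 - G 0| ≤ γ * Real.exp (1 + A) * |P 0| := by
  have hγ := h.one_lt
  have hγ0 : 0 < 1 / γ := by positivity
  have hγ1 : 0 ≤ 1 - 1 / γ := by
    rw [sub_nonneg, div_le_one (by linarith)]; exact hγ.le
  obtain ⟨c, hc, hc'⟩ := exists_ratio_hasDerivAt_eq_ratio_slope G P zero_lt_one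
    (h.cont.mono (Icc_subset_Icc_left (by norm_num)))
    (fun x hx => h.hasDeriv x ⟨by linarith [hx.1], hx.2⟩)
    (fun x => -(γ * (1 - x) ^ (1 / γ))) (fun x => (1 - x) ^ (1 / γ - 1))
    ((continuousOn_const.mul ((by fun_prop : ContinuousOn (fun x : ℝ => 1 - x) _).rpow_const
      (fun _ _ => Or.inr hγ0.le))).neg)
    (fun x hx => by
      have h1 : HasDerivAt (fun x : ℝ => 1 - x) (-1) x := by
        simpa using (hasDerivAt_id x).const_sub 1
      have h2 := ((h1.rpow_const (p := 1 / γ) (Or.inl (by linarith [hx.2]))).const_mul γ).neg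
      refine h2.congr_deriv ?_
      field_simp)
  have hc1 : 0 < 1 - c := by linarith [hc.2]
  have hpos : 0 < (1 - c) ^ (1 / γ - 1) := Real.rpow_pos_of_pos hc1 _
  have hcm : c ∈ Ioo (-1:ℝ) 1 := ⟨by linarith [hc.1], hc.2⟩
  have h0 : (0:ℝ) ∈ Ioo (-1:ℝ) 1 := by norm_num
  have hval : γ * P c = (G 1 - G 0) * (1 - c) ^ (1 / γ - 1) := by
    have e : (0:ℝ) ^ γ⁻¹ = 0 := Real.zero_rpow (by positivity)
    simpa [e] using hc'
  have hE : Real.exp ((1 - 1 / γ) * endpointLogDist c 0 + A) ≤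
      Real.exp (1 + A) * (1 - c) ^ (1 / γ - 1) := by
    rw [Real.rpow_def_of_pos hc1, ← Real.exp_add, Real.exp_le_exp]
    have l1 : Real.log (1 - c) ≤ 0 := Real.log_nonpos hc1.le (by linarith [hc.1])
    have l2 : 0 ≤ Real.log (1 + c) := Real.log_nonneg (by linarith [hc.1])
    have l3 : Real.log (1 + c) ≤ 1 := by
      have := Real.log_le_sub_one_of_pos (by linarith [hc.1] : 0 < 1 + c)
      linarith [hc.2]
    simp only [endpointLogDist, sub_zero, add_zero, Real.log_one, abs_of_nonpos l1,
      abs_of_nonneg l2]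
    nlinarith
  have h1 := (h.abs_deriv_le hcm h0).trans (mul_le_mul_of_nonneg_right hE (abs_nonneg _))
  have h2 : |G 1 - G 0| * (1 - c) ^ (1 / γ - 1) = γ * |P c| := by
    rw [← abs_of_pos hpos, ← abs_mul, ← hval, abs_mul, abs_of_pos (by linarith : 0 < γ)]
  refine le_of_mul_le_mul_right ?_ hpos
  rw [h2]
  calc γ * |P c| ≤ γ * (Real.exp (1 + A) * (1 - c) ^ (1 / γ - 1) * |P 0|) := by gcongr
    _ = _ := by ring

theorem abs_apply_one_sub_apply_neg_one_le (h : EndpointDistortion γ A G P) :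
    |G 1 - G (-1)| ≤ 2 * γ * Real.exp (1 + A) * |P 0| := by
  have h1 := h.abs_apply_one_sub_le
  have h2 := h.comp_neg.abs_apply_one_sub_le
  simp only [neg_zero, abs_neg] at h2
  calc |G 1 - G (-1)| = |(G 1 - G 0) - (G (-1) - G 0)| := by congr 1; ring
    _ ≤ _ := abs_sub _ _
    _ ≤ _ := by linarith

theorem le_abs_apply_one_sub_apply_neg_one (h : EndpointDistortion γ A G P)
    (hG : MonotoneOn G (Icc (-1) 1) ∨ AntitoneOn G (Icc (-1) 1)) :
    Real.exp (-(4 + A)) * |P 0| ≤ |G 1 - G (-1)| := by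
  have h1 := (h.abs_sub_bounds (d := 1 / 2) (p := -(1 / 2)) (q := 1 / 2) (by norm_num)
    (by norm_num) (by norm_num) (by norm_num)).1
  rw [show (2:ℝ) / (1 / 2) = 4 by norm_num, show (1 / 2 : ℝ) - -(1 / 2) = 1 by norm_num,
    mul_one] at h1
  refine h1.trans ?_
  have m1 : (-1:ℝ) ∈ Icc (-1:ℝ) 1 := by norm_num
  have m2 : (-(1 / 2):ℝ) ∈ Icc (-1:ℝ) 1 := by norm_num
  have m3 : (1 / 2:ℝ) ∈ Icc (-1:ℝ) 1 := by norm_num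
  have m4 : (1:ℝ) ∈ Icc (-1:ℝ) 1 := by norm_num
  rcases hG with hG | hG
  · have a1 := hG m1 m2 (by norm_num)
    have a2 := hG m2 m3 (by norm_num)
    have a3 := hG m3 m4 (by norm_num)
    rw [abs_of_nonneg (by linarith), abs_of_nonneg (by linarith)]
    linarith
  · have a1 := hG m1 m2 (by norm_num)
    have a2 := hG m2 m3 (by norm_num)
    have a3 := hG m3 m4 (by norm_num)
    rw [abs_of_nonpos (by linarith), abs_of_nonpos (by linarith)]
    linarith

theorem gap_ratio_bounds (h : EndpointDistortion γ A G P)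
    (hG : MonotoneOn G (Icc (-1) 1) ∨ AntitoneOn G (Icc (-1) 1)) {d p q : ℝ} (hd : 0 < d)
    (hpq : p < q) (hp : -(1 - d) ≤ p) (hq : q ≤ 1 - d) :
    Real.exp (-(2 / d + A)) / (2 * γ * Real.exp (1 + A)) * (q - p) ≤
        |G q - G p| / |G 1 - G (-1)| ∧
      |G q - G p| / |G 1 - G (-1)| ≤
        Real.exp (2 / d + A) / Real.exp (-(4 + A)) * (q - p) := by
  have hγ := h.one_lt
  obtain ⟨h1, h2⟩ := h.abs_sub_bounds hd hpq hp hq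
  have h3 := h.abs_apply_one_sub_apply_neg_one_le
  have h4 := h.le_abs_apply_one_sub_apply_neg_one hG
  have hP : 0 < |P 0| := abs_pos.2 (h.ne_zero 0 (by norm_num))
  have hT : 0 < |G 1 - G (-1)| := lt_of_lt_of_le (by positivity) h4
  have hqp : 0 < q - p := sub_pos.2 hpq
  constructor
  · rw [le_div_iff₀ hT]
    refine le_trans ?_ h1
    calc _ ≤ Real.exp (-(2 / d + A)) / (2 * γ * Real.exp (1 + A)) * (q - p) *
          (2 * γ * Real.exp (1 + A) * |P 0|) := by gcongr
      _ = _ := by field_simp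
  · rw [div_le_iff₀ hT]
    refine h2.trans ?_
    calc _ = Real.exp (2 / d + A) / Real.exp (-(4 + A)) * (q - p) *
          (Real.exp (-(4 + A)) * |P 0|) := by field_simp
      _ ≤ _ := by gcongr

end EndpointDistortion

theorem gw_append (f : ℝ → ℝ) (w v : List Bool) : gw f (w ++ v) = gw f w ∘ gw f v := by
  induction w with
  | nil => rfl
  | cons b w ih => simp only [List.cons_append, gw, ih, Function.comp_assoc]

theorem word_push (a : ℕ → Bool) (i : Bool) (n : ℕ) :
    word (push a i) (n + 1) = word a n ++ [i] := by
  simp only [word, List.range_succ_eq_map (n := n + 1), List.reverse_cons, List.map_append,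
    List.map_reverse, List.map_map, List.map_cons, List.map_nil]
  rfl

theorem ratio_push (f : ℝ → ℝ) (a : ℕ → Bool) (i : Bool) (n : ℕ) :
    ratio f (push a i) (n + 1) = len (Iw f (word a n ++ [i])) / len (Iw f (word a n)) := by
  rw [ratio, word_push, List.dropLast_concat]

namespace FoldedMap

variable {γ r R K α ε : ℝ} {f f' : ℝ → ℝ}

theorem exists_gap_endpoint (h : FoldedMap γ r R K α ε f f') (hε : 0 < ε) (b : Bool) :
    ∃ t ∈ Ioo (0:ℝ) 1, branch f b '' Icc (-1) 1 = (fun s => side b * s) '' Icc t 1 ∧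
      t ≤ 1 - 2 / R ∧ (γ / R) ^ (1 / γ) * ε ^ (1 / γ) ≤ t ∧
      t ≤ (γ / r) ^ (1 / γ) * ε ^ (1 / γ) := by
  obtain ⟨t, ht, h1, h2⟩ := h.exists_branch_eq_Ioo b (x := 1) ⟨by norm_num, by linarith⟩
  have hγ := (h b).one_lt
  have hγ0 : 0 < γ := by linarith
  have hr := (h b).r_pos
  have hR := (h b).R_pos
  refine ⟨t, ht, ?_, ?_, ?_, ?_⟩
  · apply Subset.antisymm
    · rintro _ ⟨x, hx, rfl⟩
      obtain ⟨s, hs, h3, h4⟩ := h.exists_branch_eq b (h.Icc_subset hx)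
      refine ⟨s, ⟨?_, hs.2⟩, h3.symm⟩
      by_contra! hst
      have := h.strictAntiOn b hs (Ioo_subset_Icc_self ht) hst
      simp only [h2, h4] at this
      linarith [hx.2]
    · rintro _ ⟨s, hs, rfl⟩
      have hs' : s ∈ Icc (0:ℝ) 1 := ⟨ht.1.le.trans hs.1, hs.2⟩
      have a1 := (h.strictAntiOn b).antitoneOn (Ioo_subset_Icc_self ht) hs' hs.1
      have a2 := (h.strictAntiOn b).antitoneOn hs' ⟨zero_le_one, le_rfl⟩ hs.2
      have a3 := (h b).map_one
      simp only [h2] at a1 a2 a3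
      rw [a3] at a2
      exact ⟨f (side b * s), ⟨a2, a1⟩, h.branch_apply b hs'⟩
  · have := (h b).add_one_le ht
    simp only [h2] at this
    have h3 : 2 / R ≤ 1 - t := by
      rw [div_le_iff₀ hR]; linarith
    linarith
  · have := (h b).top_sub_le ht
    simp only [h2] at this
    rw [← Real.mul_rpow (by positivity) hε.le, one_div, Real.rpow_inv_le_iff_of_pos (by positivity)
      ht.1.le hγ0, div_mul_eq_mul_div, div_le_iff₀ hR]
    calc γ * ε ≤ γ * (R / γ * t ^ γ) := by gcongr; linarith
      _ = t ^ γ * R := by field_simp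
  · have := (h b).top_sub_ge ht
    simp only [h2] at this
    rw [← Real.mul_rpow (by positivity) hε.le, one_div, Real.le_rpow_inv_iff_of_pos ht.1.le
      (by positivity) hγ0, div_mul_eq_mul_div, le_div_iff₀ hr]
    calc t ^ γ * r = γ * (r / γ * t ^ γ) := by field_simp
      _ ≤ γ * ε := by gcongr; linarith

theorem len_Iw_append_singleton (h : FoldedMap γ r R K α ε f f') (w : List Bool) {b : Bool}
    {t : ℝ} (ht : t ∈ Ioo (0:ℝ) 1)
    (hb : branch f b '' Icc (-1) 1 = (fun s => side b * s) '' Icc t 1) :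
    len (Iw f (w ++ [b])) = |gw f w (side b) - gw f w (side b * t)| := by
  have e : Iw f (w ++ [b]) = gw f w '' ((fun s => side b * s) '' Icc t 1) := by
    rw [Iw, gw_append, image_comp, ← hb]
    rfl
  rw [e]
  cases b
  · have e2 : (fun s => side false * s) '' Icc t 1 = Icc (-1) (-t) := by simp [side]
    rw [e2, h.len_image_gw w le_rfl (by linarith [ht.2]) (by linarith [ht.1]), abs_sub_comm]
    simp [side]
  · have e2 : (fun s => side true * s) '' Icc t 1 = Icc t 1 := by simp [side]
    rw [e2, h.len_image_gw w (by linarith [ht.1]) ht.2.le le_rfl]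
    simp [side]

theorem ratio_add_ratio_bounds (h : FoldedMap γ r R K α ε f f') (hε : 0 < ε) {C l : ℝ}
    (hl : 0 ≤ l) (hl' : l < 1) (hC : 0 ≤ C)
    (hdecay : ∀ b w, len (Iw f (b :: w)) ≤ C * l ^ w.length) {A : ℝ}
    (hA : A = (3 * K * γ / r + 1) * C ^ α * (1 - l ^ α)⁻¹) (w : List Bool) :
    1 - Real.exp (2 / (2 / R) + A) / Real.exp (-(4 + A)) * (2 * (γ / r) ^ (1 / γ)) * ε ^ (1 / γ) ≤
        len (Iw f (w ++ [false])) / len (Iw f w) + len (Iw f (w ++ [true])) / len (Iw f w) ∧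
      len (Iw f (w ++ [false])) / len (Iw f w) + len (Iw f (w ++ [true])) / len (Iw f w) ≤
        1 - Real.exp (-(2 / (2 / R) + A)) / (2 * γ * Real.exp (1 + A)) *
          (2 * (γ / R) ^ (1 / γ)) * ε ^ (1 / γ) := by
  have hγ := (h true).one_lt
  obtain ⟨t, ht, htI, htR, htl, htu⟩ := h.exists_gap_endpoint hε false
  obtain ⟨s, hs, hsI, hsR, hsl, hsu⟩ := h.exists_gap_endpoint hε true
  obtain ⟨P, hP, hPl⟩ := h.exists_hasDerivAt_gw_distortion hl hl' hC hdecay w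
  have hE : EndpointDistortion γ A (gw f w) P :=
    ⟨hγ, h.continuousOn_gw w, fun x hx => (hP x hx).1, fun x hx => (hP x hx).2,
      fun x hx y hy => hA ▸ hPl x hx y hy⟩
  have hG := h.strictMonoOn_or_strictAntiOn_gw w
  obtain ⟨b1, b2⟩ := hE.gap_ratio_bounds (d := 2 / R) (p := -t) (q := s)
    (hG.imp StrictMonoOn.monotoneOn StrictAntiOn.antitoneOn) (div_pos two_pos (h true).R_pos)
    (by linarith [ht.1, hs.1]) (by linarith) hsR
  have hw : len (Iw f w) = |gw f w 1 - gw f w (-1)| :=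
    h.len_image_gw w le_rfl (by norm_num) le_rfl
  have hT : 0 < |gw f w 1 - gw f w (-1)| := by
    rw [abs_pos, sub_ne_zero]
    intro he
    have := h.injOn_gw w (by norm_num) (by norm_num) he
    norm_num at this
  have hsum : |gw f w (-1) - gw f w (-t)| + |gw f w 1 - gw f w s| =
      |gw f w 1 - gw f w (-1)| - |gw f w s - gw f w (-t)| := by
    have m1 : (-1:ℝ) ∈ Icc (-1:ℝ) 1 := by norm_num
    have m2 : -t ∈ Icc (-1:ℝ) 1 := ⟨by linarith [ht.2], by linarith [ht.1]⟩
    have m3 : s ∈ Icc (-1:ℝ) 1 := ⟨by linarith [hs.1], hs.2.le⟩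
    have m4 : (1:ℝ) ∈ Icc (-1:ℝ) 1 := by norm_num
    have o1 : -1 ≤ -t := m2.1
    have o2 : -t ≤ s := by linarith [ht.1, hs.1]
    have o3 : s ≤ 1 := m3.2
    rcases hG with hG | hG
    · have a1 := hG.monotoneOn m1 m2 o1
      have a2 := hG.monotoneOn m2 m3 o2
      have a3 := hG.monotoneOn m3 m4 o3
      rw [abs_of_nonpos (by linarith), abs_of_nonneg (by linarith), abs_of_nonneg (by linarith),
        abs_of_nonneg (by linarith)]
      ring
    · have a1 := hG.antitoneOn m1 m2 o1
      have a2 := hG.antitoneOn m2 m3 o2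
      have a3 := hG.antitoneOn m3 m4 o3
      rw [abs_of_nonneg (by linarith), abs_of_nonpos (by linarith), abs_of_nonpos (by linarith),
        abs_of_nonpos (by linarith)]
      ring
  have htotal : len (Iw f (w ++ [false])) / len (Iw f w) +
      len (Iw f (w ++ [true])) / len (Iw f w) =
      1 - |gw f w s - gw f w (-t)| / |gw f w 1 - gw f w (-1)| := by
    rw [h.len_Iw_append_singleton w ht htI, h.len_Iw_append_singleton w hs hsI, hw, ← add_div]
    simp only [side, neg_one_mul, one_mul]
    rw [hsum, sub_div, div_self hT.ne']
  rw [htotal]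
  constructor
  · apply sub_le_sub_left
    refine b2.trans ?_
    rw [mul_assoc]
    apply mul_le_mul_of_nonneg_left _ (by positivity)
    linarith
  · apply sub_le_sub_left
    refine le_trans ?_ b1
    rw [mul_assoc]
    apply mul_le_mul_of_nonneg_left _ (by positivity)
    linarith

end FoldedMap

theorem GoodFamily.len_Iw_cons_le (F : GoodFamily) {r R K α ε : ℝ} (hε : ε ∈ Icc 0 F.eps0)
    (h : FoldedMap F.gamma r R K α ε (F.f ε) (F.f' ε)) (b : Bool) (w : List Bool) :
    len (Iw (F.f ε) (b :: w)) ≤ (F.C0 + 2) * F.lam ^ w.length := by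
  have hl := F.lam_mem.1
  have hC := F.C0_pos
  rcases w.length.eq_zero_or_pos with h0 | h0
  · rw [h0, pow_zero, mul_one]
    have h1 := h.len_image_gw (b :: w) le_rfl (by norm_num) (le_refl (1:ℝ))
    have m1 := h.mapsTo_gw (b :: w) (by norm_num : (-1:ℝ) ∈ Icc (-1:ℝ) 1)
    have m2 := h.mapsTo_gw (b :: w) (by norm_num : (1:ℝ) ∈ Icc (-1:ℝ) 1)
    rw [Iw, h1]
    refine (abs_le.2 ⟨?_, ?_⟩ : _ ≤ (2:ℝ)).trans (by linarith) <;>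
      linarith [m1.1, m1.2, m2.1, m2.2]
  · refine (F.decay ε hε w.length h0 (b :: w) rfl).trans ?_
    gcongr
    linarith

/-- Corollary 3: for a good family with power-law exponent `γ` and scaling
functions `s_ε`, there is a constant `C > 0` independent of `ε` such that
`1 - C⁻¹ ε^{1/γ} ≤ s_ε((a*0.)) + s_ε((a*1.)) ≤ 1 - C ε^{1/γ}` for all dual points `a*`
and all `0 < ε ≤ ε₀`. -/
theorem sum_of_scales_estimate (F : GoodFamily) (s : ℝ → (ℕ → Bool) → ℝ)
    (hs : ∀ ε ∈ Ioc 0 F.eps0, IsScalingFun (F.f ε) (s ε)) :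
    ∃ C > (0:ℝ), ∀ a : ℕ → Bool, ∀ ε ∈ Ioc 0 F.eps0,
      1 - C⁻¹ * ε ^ (1 / F.gamma) ≤ s ε (push a false) + s ε (push a true) ∧
      s ε (push a false) + s ε (push a true) ≤ 1 - C * ε ^ (1 / F.gamma) := by
  obtain ⟨r, R, K, α, hF⟩ := F.exists_foldedMap
  set A := (3 * K * F.gamma / r + 1) * (F.C0 + 2) ^ α * (1 - F.lam ^ α)⁻¹ with hA
  set c₁ := Real.exp (-(2 / (2 / R) + A)) / (2 * F.gamma * Real.exp (1 + A)) *
    (2 * (F.gamma / R) ^ (1 / F.gamma)) with hc₁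
  set c₂ := Real.exp (2 / (2 / R) + A) / Real.exp (-(4 + A)) *
    (2 * (F.gamma / r) ^ (1 / F.gamma)) with hc₂
  have h0 := hF 0 ⟨le_rfl, F.eps0_pos.le⟩ true
  have hγ : 0 < F.gamma := zero_lt_one.trans F.one_lt_gamma
  have hr := h0.r_pos
  have hR := h0.R_pos
  have hc₁_pos : 0 < c₁ := by positivity
  have hc₂_pos : 0 < c₂ := by positivity
  refine ⟨min c₁ c₂⁻¹, lt_min hc₁_pos (inv_pos.2 hc₂_pos), fun a ε hε => ?_⟩
  have hε' : ε ∈ Icc 0 F.eps0 := Ioc_subset_Icc_self hε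
  have hb := fun n => (hF ε hε').ratio_add_ratio_bounds hε.1 F.lam_mem.1.le F.lam_mem.2
    (by linarith [F.C0_pos]) (F.len_Iw_cons_le hε' (hF ε hε')) hA (word a n)
  have hpow : 0 ≤ ε ^ (1 / F.gamma) := Real.rpow_nonneg hε.1.le _
  have hlim : Tendsto (fun n => ratio (F.f ε) (push a false) (n + 1) +
      ratio (F.f ε) (push a true) (n + 1)) atTop (𝓝 (s ε (push a false) + s ε (push a true))) :=
    ((hs ε hε (push a false)).comp (tendsto_add_atTop_nat 1)).add
      ((hs ε hε (push a true)).comp (tendsto_add_atTop_nat 1))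
  simp only [ratio_push] at hlim
  constructor
  · refine le_trans ?_ (ge_of_tendsto' hlim fun n => (hb n).1)
    have : c₂ ≤ (min c₁ c₂⁻¹)⁻¹ :=
      le_inv_of_le_inv₀ (lt_min hc₁_pos (inv_pos.2 hc₂_pos)) (min_le_right _ _)
    gcongr
  · refine (le_of_tendsto' hlim fun n => (hb n).2).trans ?_
    gcongr
    exact min_le_left _ _
end
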